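/- arXiv:2103.01729 — 9 statements merged into one kernel-verified Lean document; each statement's English description precedes it below -/
import Mathlib

section
/- Let p ∈ C_q(n,k) be induced by a strategy S = (ψ ∈ ℂ^{d_A} ⊗ ℂ^{d_B}, {E_{v,i}}, {F_{w,j}}), and let ρ_A, ρ_B be the reduced density matrices of ψψ*. If ‖p − p̃‖₁ ≤ δ for some synchronous correlation p̃ ∈ C_q^s(n,k) and some δ ≥ 0, then for all i ∈ [k] and v ∈ [n]: (a) ‖(E_{v,i} ⊗ I)ψ − (I ⊗ F_{v,i})ψ‖ ≤ √δ; (b) ‖(E_{v,i} ⊗ I)ψ − (E_{v,i} ⊗ F_{v,i})ψ‖ ≤ √δ; (c) ‖(I ⊗ F_{v,i})ψ − (E_{v,i} ⊗ F_{v,i})ψ‖ ≤ √δ; (d) ‖E_{v,i} − E_{v,i}²‖_{ρ_A} ≤ 2√δ; (e) ‖F_{v,i} − F_{v,i}²‖_{ρ_B} ≤ 2√δ. -/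
open scoped Matrix Kronecker ComplexOrder

noncomputable section
namespace QST

/-- Euclidean norm of a finite complex vector. -/
def evnorm {ι : Type} [Fintype ι] (v : ι → ℂ) : ℝ :=
  Real.sqrt (∑ i, ‖v i‖ ^ 2)

/-- Inner product `⟨v, w⟩`, linear in the first argument. -/
def pinner {ι : Type} [Fintype ι] (v w : ι → ℂ) : ℂ :=
  ∑ i, v i * (starRingEnd ℂ) (w i)

/-- Reduced density matrix of `ψψ*` on the first tensor factor. -/
def rhoA {dA dB : ℕ} (ψ : Fin dA × Fin dB → ℂ) : Matrix (Fin dA) (Fin dA) ℂ :=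
  Matrix.of fun a a' => ∑ b, ψ (a, b) * (starRingEnd ℂ) (ψ (a', b))

/-- Reduced density matrix of `ψψ*` on the second tensor factor. -/
def rhoB {dA dB : ℕ} (ψ : Fin dA × Fin dB → ℂ) : Matrix (Fin dB) (Fin dB) ℂ :=
  Matrix.of fun b b' => ∑ a, ψ (a, b) * (starRingEnd ℂ) (ψ (a, b'))

/-- The state-dependent seminorm `‖X‖_ρ = (tr (X* X ρ))^(1/2)`. -/
def rnorm {d : ℕ} (ρ X : Matrix (Fin d) (Fin d) ℂ) : ℝ :=
  Real.sqrt ((Xᴴ * X * ρ).trace).re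

/-- Operator (spectral) norm of a matrix. -/
def opNorm {d : ℕ} (X : Matrix (Fin d) (Fin d) ℂ) : ℝ :=
  ‖Matrix.toEuclideanCLM (𝕜 := ℂ) X‖

/-- `P = P* = P²`. -/
def IsProjection {d : ℕ} (P : Matrix (Fin d) (Fin d) ℂ) : Prop :=
  Pᴴ = P ∧ P * P = P

/-- 1-norm distance between correlations. -/
def dist1 {n k : ℕ} (p q : Fin n → Fin n → Fin k → Fin k → ℝ) : ℝ :=
  ∑ v, ∑ w, ∑ i, ∑ j, |p v w i j - q v w i j|

/-- Membership in the set `C_q(n,k)` of quantum correlations. -/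
def IsQuantumCorrelation (n k : ℕ) (p : Fin n → Fin n → Fin k → Fin k → ℝ) : Prop :=
  ∃ (dA dB : ℕ) (ψ : Fin dA × Fin dB → ℂ)
    (E : Fin n → Fin k → Matrix (Fin dA) (Fin dA) ℂ)
    (F : Fin n → Fin k → Matrix (Fin dB) (Fin dB) ℂ),
    evnorm ψ = 1 ∧ (∀ v i, (E v i).PosSemidef) ∧ (∀ v, ∑ i, E v i = 1) ∧
    (∀ w j, (F w j).PosSemidef) ∧ (∀ w, ∑ j, F w j = 1) ∧
    ∀ v w i j, (p v w i j : ℂ) = pinner ((E v i ⊗ₖ F w j).mulVec ψ) ψ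

/-- Strategy 1 (the "tilde" strategy) is a local `ε`-dilation of strategy 2. -/
def IsLocalDilation {n k : ℕ} (ε : ℝ) {d1A d1B d2A d2B : ℕ}
    (ψ1 : Fin d1A × Fin d1B → ℂ)
    (E1 : Fin n → Fin k → Matrix (Fin d1A) (Fin d1A) ℂ)
    (F1 : Fin n → Fin k → Matrix (Fin d1B) (Fin d1B) ℂ)
    (ψ2 : Fin d2A × Fin d2B → ℂ)
    (E2 : Fin n → Fin k → Matrix (Fin d2A) (Fin d2A) ℂ)
    (F2 : Fin n → Fin k → Matrix (Fin d2B) (Fin d2B) ℂ) : Prop :=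
  ∃ (kA kB : ℕ) (VA : Matrix (Fin d1A × Fin kA) (Fin d2A) ℂ)
    (VB : Matrix (Fin d1B × Fin kB) (Fin d2B) ℂ) (χ : Fin kA × Fin kB → ℂ),
    VAᴴ * VA = 1 ∧ VBᴴ * VB = 1 ∧ evnorm χ = 1 ∧
    evnorm (fun y : (Fin d1A × Fin d1B) × (Fin kA × Fin kB) =>
        ((VA ⊗ₖ VB).mulVec ψ2) ((y.1.1, y.2.1), (y.1.2, y.2.2)) - ψ1 y.1 * χ y.2) ≤ ε ∧
    ∀ (v w : Fin n) (i j : Fin k),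
      evnorm (fun y : (Fin d1A × Fin d1B) × (Fin kA × Fin kB) =>
        ((VA ⊗ₖ VB).mulVec ((E2 v i ⊗ₖ F2 w j).mulVec ψ2)) ((y.1.1, y.2.1), (y.1.2, y.2.2))
          - ((E1 v i ⊗ₖ F1 w j).mulVec ψ1) y.1 * χ y.2) ≤ ε

/-- The sequence generating `Λ_n` for `n ≥ 4`. -/
def lambdaSeq (n : ℕ) : ℕ → ℝ
  | 0 => 0
  | l + 1 => 1 + 1 / ((n : ℝ) - 1 - lambdaSeq n l)

/-- The sets `Λ_n`. -/
def Lambda (n : ℕ) : Set ℝ :=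
  if n = 3 then {3 / 2} else Set.range (lambdaSeq n)

/-- The maximally entangled state `φ_d`. -/
def phid (d : ℕ) : Fin d × Fin d → ℂ :=
  fun y => if y.1 = y.2 then (((Real.sqrt d)⁻¹ : ℝ) : ℂ) else 0

/-- The two-outcome measurement `{M, 1 - M}`. -/
def canonPair {d : ℕ} (M : Matrix (Fin d) (Fin d) ℂ) : Fin 2 → Matrix (Fin d) (Fin d) ℂ :=
  fun i => if i = 0 then M else 1 - M

def qf {ι : Type} [Fintype ι] (x : ι → ℂ) (M : Matrix ι ι ℂ) : ℝ := (pinner (M.mulVec x) x).re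

lemma pinner_eq {ι : Type} [Fintype ι] (x y : ι → ℂ) : pinner x y = x ⬝ᵥ star y := rfl

lemma qf_add {ι : Type} [Fintype ι] (x : ι → ℂ) (M N : Matrix ι ι ℂ) :
    qf x (M + N) = qf x M + qf x N := by
  simp [qf, pinner_eq, Matrix.add_mulVec, add_dotProduct]

lemma qf_sub {ι : Type} [Fintype ι] (x : ι → ℂ) (M N : Matrix ι ι ℂ) :
    qf x (M - N) = qf x M - qf x N := by
  simp [qf, pinner_eq, Matrix.sub_mulVec, sub_dotProduct]

lemma qf_sum {ι κ : Type} [Fintype ι] (x : ι → ℂ) (s : Finset κ) (M : κ → Matrix ι ι ℂ) :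
    qf x (∑ j ∈ s, M j) = ∑ j ∈ s, qf x (M j) := by
  classical
  induction s using Finset.induction_on with
  | empty => simp [qf, pinner_eq]
  | insert a s ha ih => rw [Finset.sum_insert ha, Finset.sum_insert ha, qf_add, ih]

lemma qf_nonneg {ι : Type} [Fintype ι] (x : ι → ℂ) {M : Matrix ι ι ℂ} (h : M.PosSemidef) :
    0 ≤ qf x M := by
  have := h.dotProduct_mulVec_nonneg x
  rw [qf, pinner_eq, dotProduct_comm]
  exact (Complex.le_def.mp this).1

lemma evnorm_sq {ι : Type} [Fintype ι] (x : ι → ℂ) : evnorm x ^ 2 = (x ⬝ᵥ star x).re := by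
  rw [evnorm, Real.sq_sqrt (Finset.sum_nonneg fun _ _ => by positivity)]
  simp only [dotProduct, Complex.re_sum, Pi.star_apply]
  refine Finset.sum_congr rfl fun i _ => ?_
  rw [Complex.star_def, Complex.mul_conj, Complex.ofReal_re, Complex.normSq_eq_norm_sq]

lemma evnorm_nonneg {ι : Type} [Fintype ι] (x : ι → ℂ) : 0 ≤ evnorm x := Real.sqrt_nonneg _

lemma evnorm_mulVec_sq {ι : Type} [Fintype ι] (x : ι → ℂ) (M : Matrix ι ι ℂ) :
    evnorm (M.mulVec x) ^ 2 = qf x (Mᴴ * M) := by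
  rw [evnorm_sq, qf, pinner_eq, ← Matrix.mulVec_mulVec, dotProduct_comm, Matrix.star_mulVec,
    ← Matrix.dotProduct_mulVec, dotProduct_comm]

lemma evnorm_add_le {ι : Type} [Fintype ι] (x y : ι → ℂ) :
    evnorm (x + y) ≤ evnorm x + evnorm y := by
  have h : ∀ z : ι → ℂ, evnorm z = ‖(WithLp.toLp 2 z : EuclideanSpace ℂ ι)‖ := fun z => by
    rw [EuclideanSpace.norm_eq]; rfl
  rw [h, h, h, WithLp.toLp_add]
  exact norm_add_le _ _

lemma psd_sub_sq {ι : Type} [Fintype ι] [DecidableEq ι] {C : Matrix ι ι ℂ} (h : C.PosSemidef)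
    (h1 : (1 - C).PosSemidef) : (C - C * C).PosSemidef := by
  have e : C - C * C = C * (1 - C) * Cᴴ + (1 - C) * C * (1 - C)ᴴ := by
    rw [h1.isHermitian.eq, h.isHermitian.eq]; noncomm_ring
  rw [e]
  exact (h1.mul_mul_conjTranspose_same C).add (h.mul_mul_conjTranspose_same (1 - C))

lemma evnorm_sq_le {ι : Type} [Fintype ι] [DecidableEq ι] (x : ι → ℂ) {C : Matrix ι ι ℂ}
    (h : C.PosSemidef) (h1 : (1 - C).PosSemidef) : evnorm (C.mulVec x) ^ 2 ≤ qf x C := by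
  have := qf_nonneg x (psd_sub_sq h h1)
  rw [qf_sub] at this
  rw [evnorm_mulVec_sq, h.isHermitian.eq]; linarith

lemma evnorm_contract {ι : Type} [Fintype ι] [DecidableEq ι] (x : ι → ℂ) {C : Matrix ι ι ℂ}
    (h : C.PosSemidef) (h1 : (1 - C).PosSemidef) : evnorm (C.mulVec x) ≤ evnorm x := by
  have a := evnorm_sq_le x h h1
  have b := qf_nonneg x h1
  have c : qf x 1 = evnorm x ^ 2 := by rw [evnorm_sq, qf, pinner_eq, Matrix.one_mulVec]
  rw [qf_sub, c] at b
  exact (sq_le_sq₀ (evnorm_nonneg _) (evnorm_nonneg _)).mp (by linarith)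

lemma rnormA {dA dB : ℕ} (ψ : Fin dA × Fin dB → ℂ) (X : Matrix (Fin dA) (Fin dA) ℂ) :
    rnorm (rhoA ψ) X = evnorm ((X ⊗ₖ (1 : Matrix (Fin dB) (Fin dB) ℂ)).mulVec ψ) := by
  set P : Matrix (Fin dA) (Fin dB) ℂ := Matrix.of fun a b => ψ (a, b)
  have e : rhoA ψ = P * Pᴴ := by
    ext a a'; simp [rhoA, P, Matrix.mul_apply]
  have f : ∀ a b, ((X ⊗ₖ (1 : Matrix (Fin dB) (Fin dB) ℂ)).mulVec ψ) (a, b) = (X * P) a b := by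
    intro a b
    simp [Matrix.mulVec, dotProduct, Fintype.sum_prod_type, Matrix.mul_apply, P,
      Matrix.one_apply]
  have g : (Xᴴ * X * rhoA ψ).trace = ((X * P) * (X * P)ᴴ).trace := by
    rw [e, Matrix.conjTranspose_mul, Matrix.mul_assoc, Matrix.trace_mul_comm]
    simp only [Matrix.mul_assoc]
  rw [rnorm, g, ← Real.sqrt_sq (evnorm_nonneg _), evnorm_sq]
  congr 2
  simp [-Matrix.conjTranspose_mul, Matrix.trace, Matrix.mul_apply (M := X * P), dotProduct, Fintype.sum_prod_type, f]

lemma rnormB {dA dB : ℕ} (ψ : Fin dA × Fin dB → ℂ) (X : Matrix (Fin dB) (Fin dB) ℂ) :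
    rnorm (rhoB ψ) X = evnorm (((1 : Matrix (Fin dA) (Fin dA) ℂ) ⊗ₖ X).mulVec ψ) := by
  set P : Matrix (Fin dB) (Fin dA) ℂ := Matrix.of fun b a => ψ (a, b)
  have e : rhoB ψ = P * Pᴴ := by
    ext a a'; simp [rhoB, P, Matrix.mul_apply]
  have f : ∀ a b, (((1 : Matrix (Fin dA) (Fin dA) ℂ) ⊗ₖ X).mulVec ψ) (a, b) = (X * P) b a := by
    intro a b
    simp only [Matrix.mulVec, dotProduct, Fintype.sum_prod_type_right, Matrix.mul_apply, P]
    simp [Matrix.one_apply]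
  have g : (Xᴴ * X * rhoB ψ).trace = ((X * P) * (X * P)ᴴ).trace := by
    rw [e, Matrix.conjTranspose_mul, Matrix.mul_assoc, Matrix.trace_mul_comm]
    simp only [Matrix.mul_assoc]
  rw [rnorm, g, ← Real.sqrt_sq (evnorm_nonneg _), evnorm_sq]
  congr 2
  simp [-Matrix.conjTranspose_mul, Matrix.trace, Matrix.mul_apply (M := X * P), dotProduct, Fintype.sum_prod_type_right, f]

lemma one_sub_eq {d k : ℕ} {E : Fin k → Matrix (Fin d) (Fin d) ℂ} (hs : ∑ i, E i = 1) (i : Fin k) :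
    1 - E i = ∑ j ∈ Finset.univ.erase i, E j := by
  rw [← hs, ← Finset.add_sum_erase _ _ (Finset.mem_univ i), add_sub_cancel_left]

lemma one_sub_psd {d k : ℕ} {E : Fin k → Matrix (Fin d) (Fin d) ℂ} (hE : ∀ i, (E i).PosSemidef)
    (hs : ∑ i, E i = 1) (i : Fin k) : (1 - E i).PosSemidef := by
  rw [one_sub_eq hs]
  exact Matrix.posSemidef_sum _ fun j _ => hE j

lemma sub_kron' {dA dB : ℕ} (X Y : Matrix (Fin dA) (Fin dA) ℂ) (Z : Matrix (Fin dB) (Fin dB) ℂ) :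
    (X - Y) ⊗ₖ Z = X ⊗ₖ Z - Y ⊗ₖ Z := by
  ext a b; simp [sub_mul]

lemma kron_sub' {dA dB : ℕ} (X : Matrix (Fin dA) (Fin dA) ℂ) (Y Z : Matrix (Fin dB) (Fin dB) ℂ) :
    X ⊗ₖ (Y - Z) = X ⊗ₖ Y - X ⊗ₖ Z := by
  ext a b; simp [mul_sub]

lemma one_sub_kron {dA dB : ℕ} {E : Matrix (Fin dA) (Fin dA) ℂ} {F : Matrix (Fin dB) (Fin dB) ℂ}
    (hE : E.PosSemidef) (hE1 : (1 - E).PosSemidef) (hF1 : (1 - F).PosSemidef) :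
    (1 - E ⊗ₖ F).PosSemidef := by
  have e : 1 - E ⊗ₖ F = (1 - E) ⊗ₖ (1 : Matrix (Fin dB) (Fin dB) ℂ) + E ⊗ₖ (1 - F) := by
    rw [sub_kron', kron_sub', Matrix.one_kronecker_one]; abel
  rw [e]
  exact (hE1.kronecker Matrix.PosSemidef.one).add (hE.kronecker hF1)

lemma offdiag {k : ℕ} (D : Fin k → Fin k → ℝ) (i : Fin k) :
    ∑ j ∈ Finset.univ.erase i, |D i j| + ∑ j ∈ Finset.univ.erase i, |D j i| ≤ ∑ a, ∑ b, |D a b| := by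
  rw [← Finset.add_sum_erase (Finset.univ) (fun a => ∑ b, |D a b|) (Finset.mem_univ i)]
  refine add_le_add ?_ ?_
  · exact Finset.sum_le_sum_of_subset_of_nonneg (Finset.subset_univ _) fun _ _ _ => abs_nonneg _
  · exact Finset.sum_le_sum fun j _ =>
      Finset.single_le_sum (f := fun b => |D j b|) (fun _ _ => abs_nonneg _) (Finset.mem_univ i)

theorem statement0 {n k dA dB : ℕ} (δ : ℝ) (hδ : 0 ≤ δ)
    (ψ : Fin dA × Fin dB → ℂ)
    (E : Fin n → Fin k → Matrix (Fin dA) (Fin dA) ℂ)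
    (F : Fin n → Fin k → Matrix (Fin dB) (Fin dB) ℂ)
    (hψ : evnorm ψ = 1)
    (hEpos : ∀ v i, (E v i).PosSemidef) (hEsum : ∀ v, ∑ i, E v i = 1)
    (hFpos : ∀ w j, (F w j).PosSemidef) (hFsum : ∀ w, ∑ j, F w j = 1)
    (p pt : Fin n → Fin n → Fin k → Fin k → ℝ)
    (hp : ∀ v w i j, (p v w i j : ℂ) = pinner ((E v i ⊗ₖ F w j).mulVec ψ) ψ)
    (hpt : IsQuantumCorrelation n k pt)
    (hsync : ∀ (v : Fin n) (i j : Fin k), i ≠ j → pt v v i j = 0)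
    (hdist : dist1 p pt ≤ δ) (v : Fin n) (i : Fin k) :
    evnorm ((E v i ⊗ₖ (1 : Matrix (Fin dB) (Fin dB) ℂ)).mulVec ψ
        - ((1 : Matrix (Fin dA) (Fin dA) ℂ) ⊗ₖ F v i).mulVec ψ) ≤ Real.sqrt δ ∧
    evnorm ((E v i ⊗ₖ (1 : Matrix (Fin dB) (Fin dB) ℂ)).mulVec ψ
        - (E v i ⊗ₖ F v i).mulVec ψ) ≤ Real.sqrt δ ∧
    evnorm (((1 : Matrix (Fin dA) (Fin dA) ℂ) ⊗ₖ F v i).mulVec ψ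
        - (E v i ⊗ₖ F v i).mulVec ψ) ≤ Real.sqrt δ ∧
    rnorm (rhoA ψ) (E v i - E v i * E v i) ≤ 2 * Real.sqrt δ ∧
    rnorm (rhoB ψ) (F v i - F v i * F v i) ≤ 2 * Real.sqrt δ := by
  set e := E v i with he
  set f := F v i with hf
  have he0 : e.PosSemidef := hEpos v i
  have hf0 : f.PosSemidef := hFpos v i
  have he1 : (1 - e).PosSemidef := one_sub_psd (hEpos v) (hEsum v) i
  have hf1 : (1 - f).PosSemidef := one_sub_psd (hFpos v) (hFsum v) i
  have hq : ∀ i j, qf ψ (E v i ⊗ₖ F v j) = p v v i j := fun i j => by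
    rw [qf, ← hp]; simp
  have ha : qf ψ (e ⊗ₖ (1 - f)) = ∑ j ∈ Finset.univ.erase i, p v v i j := by
    have : e ⊗ₖ (1 - f) = ∑ j ∈ Finset.univ.erase i, E v i ⊗ₖ F v j := by
      rw [hf, one_sub_eq (hFsum v)]
      ext a b
      simp [Matrix.sum_apply, Finset.mul_sum, he, mul_sub]
    rw [this, qf_sum]; simp only [hq]
  have hb : qf ψ ((1 - e) ⊗ₖ f) = ∑ j ∈ Finset.univ.erase i, p v v j i := by
    have : (1 - e) ⊗ₖ f = ∑ j ∈ Finset.univ.erase i, E v j ⊗ₖ F v i := by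
      rw [he, one_sub_eq (hEsum v)]
      ext a b
      simp [Matrix.sum_apply, Finset.sum_mul, hf, sub_mul]
    rw [this, qf_sum]; simp only [hq]
  have hab : qf ψ (e ⊗ₖ (1 - f)) + qf ψ ((1 - e) ⊗ₖ f) ≤ δ := by
    refine le_trans ?_ hdist
    have h1 : ∑ a, ∑ b, |p v v a b - pt v v a b| ≤ dist1 p pt := by
      unfold dist1
      refine le_trans ?_ (Finset.single_le_sum
        (f := fun v => ∑ w, ∑ i, ∑ j, |p v w i j - pt v w i j|)
        (fun _ _ => by positivity) (Finset.mem_univ v))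
      exact Finset.single_le_sum
        (f := fun w => ∑ i, ∑ j, |p v w i j - pt v w i j|)
        (fun _ _ => by positivity) (Finset.mem_univ v)
    refine le_trans ?_ (le_trans (offdiag (fun a b => p v v a b - pt v v a b) i) h1)
    rw [ha, hb]
    refine add_le_add (Finset.sum_le_sum fun j hj => ?_) (Finset.sum_le_sum fun j hj => ?_)
    · rw [hsync v i j (Finset.ne_of_mem_erase hj).symm, sub_zero]; exact le_abs_self _
    · rw [hsync v j i (Finset.ne_of_mem_erase hj), sub_zero]; exact le_abs_self _
  have ha0 : 0 ≤ qf ψ (e ⊗ₖ (1 - f)) := qf_nonneg _ (he0.kronecker hf1)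
  have hb0 : 0 ≤ qf ψ ((1 - e) ⊗ₖ f) := qf_nonneg _ (he1.kronecker hf0)
  have hff : (1 - (1 - f)).PosSemidef := by simpa using hf0
  have hee : (1 - (1 - e)).PosSemidef := by simpa using he0
  set A := e ⊗ₖ (1 : Matrix (Fin dB) (Fin dB) ℂ) with hA
  set B := (1 : Matrix (Fin dA) (Fin dA) ℂ) ⊗ₖ f with hB
  have hA0 : A.PosSemidef := he0.kronecker Matrix.PosSemidef.one
  have hB0 : B.PosSemidef := Matrix.PosSemidef.one.kronecker hf0
  have hA1 : (1 - A).PosSemidef := one_sub_kron he0 he1 (by simpa using Matrix.PosSemidef.zero)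
  have hB1 : (1 - B).PosSemidef :=
    one_sub_kron Matrix.PosSemidef.one (by simpa using Matrix.PosSemidef.zero) hf1
  have hAB : e ⊗ₖ f = A * B := by
    rw [hA, hB, ← Matrix.mul_kronecker_mul, Matrix.mul_one, Matrix.one_mul]
  have hBA : e ⊗ₖ f = B * A := by
    rw [hA, hB, ← Matrix.mul_kronecker_mul, Matrix.mul_one, Matrix.one_mul]
  have hk1 : e ⊗ₖ (1 - f) = A - e ⊗ₖ f := by rw [kron_sub']
  have hk2 : (1 - e) ⊗ₖ f = B - e ⊗ₖ f := by rw [sub_kron']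
  have Hb : evnorm (A.mulVec ψ - (e ⊗ₖ f).mulVec ψ) ≤ Real.sqrt δ := by
    rw [← Matrix.sub_mulVec, ← hk1]
    apply Real.le_sqrt_of_sq_le
    have := evnorm_sq_le ψ (he0.kronecker hf1) (one_sub_kron he0 he1 hff)
    linarith
  have Hc : evnorm (B.mulVec ψ - (e ⊗ₖ f).mulVec ψ) ≤ Real.sqrt δ := by
    rw [← Matrix.sub_mulVec, ← hk2]
    apply Real.le_sqrt_of_sq_le
    have := evnorm_sq_le ψ (he1.kronecker hf0) (one_sub_kron he1 hee hf1)
    linarith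
  have key : qf ψ ((A - B)ᴴ * (A - B)) ≤ δ := by
    have h1 := qf_nonneg ψ (psd_sub_sq hA0 hA1)
    have h2 := qf_nonneg ψ (psd_sub_sq hB0 hB1)
    have h3 : (A - B)ᴴ * (A - B) + (A - A * A) + (B - B * B) = (A - e ⊗ₖ f) + (B - e ⊗ₖ f) := by
      rw [Matrix.conjTranspose_sub, hA0.isHermitian.eq, hB0.isHermitian.eq]
      nth_rewrite 1 [hAB]
      rw [hBA]
      noncomm_ring
    have h4 := congrArg (qf ψ) h3
    rw [qf_add, qf_add, qf_add, ← hk1, ← hk2] at h4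
    linarith
  have Ha : evnorm (A.mulVec ψ - B.mulVec ψ) ≤ Real.sqrt δ := by
    rw [← Matrix.sub_mulVec]
    apply Real.le_sqrt_of_sq_le
    rw [evnorm_mulVec_sq]; exact key
  have Ha' : evnorm (B.mulVec ψ - A.mulVec ψ) ≤ Real.sqrt δ := by
    rw [← Matrix.sub_mulVec]
    apply Real.le_sqrt_of_sq_le
    rw [evnorm_mulVec_sq]
    refine le_of_eq_of_le ?_ key
    rw [← neg_sub A B, Matrix.conjTranspose_neg, neg_mul_neg]
  refine ⟨Ha, Hb, Hc, ?_, ?_⟩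
  · rw [rnormA]
    have h : ((e - e * e) ⊗ₖ (1 : Matrix (Fin dB) (Fin dB) ℂ)).mulVec ψ =
        (A.mulVec ψ - (e ⊗ₖ f).mulVec ψ) + A.mulVec (B.mulVec ψ - A.mulVec ψ) := by
      have : (e - e * e) ⊗ₖ (1 : Matrix (Fin dB) (Fin dB) ℂ) = A - A * A := by
        rw [sub_kron', hA, ← Matrix.mul_kronecker_mul, Matrix.mul_one]
      rw [this, hAB, Matrix.mulVec_sub, Matrix.mulVec_mulVec, Matrix.mulVec_mulVec,
        Matrix.sub_mulVec]
      abel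
    rw [h]
    have h1 := evnorm_add_le (A.mulVec ψ - (e ⊗ₖ f).mulVec ψ) (A.mulVec (B.mulVec ψ - A.mulVec ψ))
    have h2 := evnorm_contract (B.mulVec ψ - A.mulVec ψ) hA0 hA1
    linarith
  · rw [rnormB]
    have h : ((1 : Matrix (Fin dA) (Fin dA) ℂ) ⊗ₖ (f - f * f)).mulVec ψ =
        (B.mulVec ψ - (e ⊗ₖ f).mulVec ψ) + B.mulVec (A.mulVec ψ - B.mulVec ψ) := by
      have : (1 : Matrix (Fin dA) (Fin dA) ℂ) ⊗ₖ (f - f * f) = B - B * B := by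
        rw [kron_sub', hB, ← Matrix.mul_kronecker_mul, Matrix.mul_one]
      rw [this, hBA, Matrix.mulVec_sub, Matrix.mulVec_mulVec, Matrix.mulVec_mulVec,
        Matrix.sub_mulVec]
      abel
    rw [h]
    have h1 := evnorm_add_le (B.mulVec ψ - (e ⊗ₖ f).mulVec ψ) (B.mulVec (A.mulVec ψ - B.mulVec ψ))
    have h2 := evnorm_contract (A.mulVec ψ - B.mulVec ψ) hB0 hB1
    linarith

end QST
end
end

section
/- Let p ∈ C_q^s(n,k) be a synchronous correlation induced by a strategy S = (ψ ∈ ℂ^{d_A} ⊗ ℂ^{d_B}, {E_{v,i}}, {F_{w,j}}). Then for all i ∈ [k] and v ∈ [n]: (a) (E_{v,i} ⊗ I)ψ = (I ⊗ F_{v,i})ψ; (b) (E_{v,i} ⊗ I)ψ = (E_{v,i}² ⊗ I)ψ; (c) (I ⊗ F_{v,i})ψ = (I ⊗ F_{v,i}²)ψ. Moreover, if ψ has full Schmidt rank r = d_A = d_B, then each E_{v,i} and each F_{v,i} is a projection, and F_{v,i} = Dᵀ E_{v,i}ᵀ (D⁻¹)ᵀ, where D ∈ M_r(ℂ) is the matrix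 with vec(D) = ψ. -/
open scoped Matrix Kronecker ComplexOrder

noncomputable section
namespace QST

theorem pinner_zero {ι : Type} [Fintype ι] (M : Matrix ι ι ℂ) (hM : M.PosSemidef) (ψ : ι → ℂ)
    (h : pinner (M.mulVec ψ) ψ = 0) : M.mulVec ψ = 0 := by
  rw [← hM.dotProduct_mulVec_zero_iff]
  rw [← h]
  simp [pinner, dotProduct, mul_comm]

theorem kron_vec {d : ℕ} (X Y D : Matrix (Fin d) (Fin d) ℂ) (a b : Fin d) :
    (X ⊗ₖ Y).mulVec (fun p => D p.1 p.2) (a, b) = (X * D * Yᵀ) a b := by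
  simp only [Matrix.mulVec, dotProduct, Matrix.kroneckerMap_apply, Matrix.mul_apply,
    Matrix.transpose_apply, Fintype.sum_prod_type, Finset.sum_mul]
  rw [Finset.sum_comm]
  refine Finset.sum_congr rfl fun _ _ => Finset.sum_congr rfl fun _ _ => by ring

theorem statement1 {n k dA dB : ℕ}
    (ψ : Fin dA × Fin dB → ℂ)
    (E : Fin n → Fin k → Matrix (Fin dA) (Fin dA) ℂ)
    (F : Fin n → Fin k → Matrix (Fin dB) (Fin dB) ℂ)
    (hψ : evnorm ψ = 1)
    (hEpos : ∀ v i, (E v i).PosSemidef) (hEsum : ∀ v, ∑ i, E v i = 1)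
    (hFpos : ∀ w j, (F w j).PosSemidef) (hFsum : ∀ w, ∑ j, F w j = 1)
    (hsync : ∀ (v : Fin n) (i j : Fin k), i ≠ j →
      pinner ((E v i ⊗ₖ F v j).mulVec ψ) ψ = 0) :
    (∀ v i, (E v i ⊗ₖ (1 : Matrix (Fin dB) (Fin dB) ℂ)).mulVec ψ
        = ((1 : Matrix (Fin dA) (Fin dA) ℂ) ⊗ₖ F v i).mulVec ψ) ∧
    (∀ v i, (E v i ⊗ₖ (1 : Matrix (Fin dB) (Fin dB) ℂ)).mulVec ψ
        = ((E v i * E v i) ⊗ₖ (1 : Matrix (Fin dB) (Fin dB) ℂ)).mulVec ψ) ∧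
    (∀ v i, ((1 : Matrix (Fin dA) (Fin dA) ℂ) ⊗ₖ F v i).mulVec ψ
        = ((1 : Matrix (Fin dA) (Fin dA) ℂ) ⊗ₖ (F v i * F v i)).mulVec ψ) ∧
    (∀ hd : dB = dA,
      IsUnit (Matrix.of fun a b : Fin dA => ψ (a, Fin.cast hd.symm b)).det →
      ∀ v i, IsProjection (E v i) ∧ IsProjection (F v i) ∧
        (F v i).submatrix (Fin.cast hd.symm) (Fin.cast hd.symm) =
          (Matrix.of fun a b : Fin dA => ψ (a, Fin.cast hd.symm b))ᵀ * (E v i)ᵀ *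
            ((Matrix.of fun a b : Fin dA => ψ (a, Fin.cast hd.symm b))⁻¹)ᵀ) := by
  have h0 : ∀ v i j, i ≠ j → (E v i ⊗ₖ F v j).mulVec ψ = 0 := fun v i j hij =>
    pinner_zero _ ((hEpos v i).kronecker (hFpos v j)) ψ (hsync v i j hij)
  have hA : ∀ v i, (E v i ⊗ₖ (1 : Matrix (Fin dB) (Fin dB) ℂ)).mulVec ψ
      = (E v i ⊗ₖ F v i).mulVec ψ := by
    intro v i
    have h1 : E v i ⊗ₖ (1 : Matrix (Fin dB) (Fin dB) ℂ) = ∑ j, E v i ⊗ₖ F v j := by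
      rw [← hFsum v]
      ext x y
      simp [Matrix.sum_apply, Finset.mul_sum]
    rw [h1, Matrix.sum_mulVec]
    exact Finset.sum_eq_single i (fun j _ hj => h0 v i j hj.symm) (by simp)
  have hB : ∀ v i, ((1 : Matrix (Fin dA) (Fin dA) ℂ) ⊗ₖ F v i).mulVec ψ
      = (E v i ⊗ₖ F v i).mulVec ψ := by
    intro v i
    have h1 : (1 : Matrix (Fin dA) (Fin dA) ℂ) ⊗ₖ F v i = ∑ j, E v j ⊗ₖ F v i := by
      rw [← hEsum v]
      ext x y
      simp [Matrix.sum_apply, Finset.sum_mul]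
    rw [h1, Matrix.sum_mulVec]
    exact Finset.sum_eq_single i (fun j _ hj => h0 v j i hj) (by simp)
  have ha : ∀ v i, (E v i ⊗ₖ (1 : Matrix (Fin dB) (Fin dB) ℂ)).mulVec ψ
        = ((1 : Matrix (Fin dA) (Fin dA) ℂ) ⊗ₖ F v i).mulVec ψ := fun v i =>
    (hA v i).trans (hB v i).symm
  have hb : ∀ v i, (E v i ⊗ₖ (1 : Matrix (Fin dB) (Fin dB) ℂ)).mulVec ψ
        = ((E v i * E v i) ⊗ₖ (1 : Matrix (Fin dB) (Fin dB) ℂ)).mulVec ψ := by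
    intro v i
    have h1 : (E v i * E v i) ⊗ₖ (1 : Matrix (Fin dB) (Fin dB) ℂ)
        = (E v i ⊗ₖ 1) * (E v i ⊗ₖ 1) := by
      rw [← Matrix.mul_kronecker_mul, one_mul]
    rw [h1, ← Matrix.mulVec_mulVec, ha, Matrix.mulVec_mulVec, ← Matrix.mul_kronecker_mul,
      one_mul, mul_one, hB]
  have hc : ∀ v i, ((1 : Matrix (Fin dA) (Fin dA) ℂ) ⊗ₖ F v i).mulVec ψ
        = ((1 : Matrix (Fin dA) (Fin dA) ℂ) ⊗ₖ (F v i * F v i)).mulVec ψ := by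
    intro v i
    have h1 : (1 : Matrix (Fin dA) (Fin dA) ℂ) ⊗ₖ (F v i * F v i)
        = (1 ⊗ₖ F v i) * (1 ⊗ₖ F v i) := by
      rw [← Matrix.mul_kronecker_mul, one_mul]
    rw [h1, ← Matrix.mulVec_mulVec, ← ha, Matrix.mulVec_mulVec, ← Matrix.mul_kronecker_mul,
      one_mul, mul_one, hA]
  refine ⟨ha, hb, hc, ?_⟩
  intro hd
  subst hd
  simp only [Fin.cast_eq_self]
  intro hU v i
  set D : Matrix (Fin dB) (Fin dB) ℂ := Matrix.of fun a b => ψ (a, b) with hD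
  have hψD : ψ = fun p => D p.1 p.2 := rfl
  have key : ∀ X Y X' Y' : Matrix (Fin dB) (Fin dB) ℂ,
      (X ⊗ₖ Y).mulVec ψ = (X' ⊗ₖ Y').mulVec ψ → X * D * Yᵀ = X' * D * Y'ᵀ := by
    intro X Y X' Y' h
    ext a b
    rw [← kron_vec, ← kron_vec]
    exact congrFun h (a, b)
  have ka := key _ _ _ _ (ha v i)
  have kb := key _ _ _ _ (hb v i)
  have kc := key _ _ _ _ (hc v i)
  simp only [Matrix.transpose_one, mul_one, one_mul] at ka kb kc
  have hDD : D * D⁻¹ = 1 := Matrix.mul_nonsing_inv D hU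
  have hDD' : D⁻¹ * D = 1 := Matrix.nonsing_inv_mul D hU
  refine ⟨⟨(hEpos v i).isHermitian, ?_⟩, ⟨(hFpos v i).isHermitian, ?_⟩, ?_⟩
  · have := congrArg (· * D⁻¹) kb
    simp only [Matrix.mul_assoc, hDD, mul_one] at this
    exact this.symm
  · have := congrArg (D⁻¹ * ·) kc
    simp only [← Matrix.mul_assoc, hDD', one_mul] at this
    exact (Matrix.transpose_injective this).symm
  · have := congrArg (D⁻¹ * ·) ka
    simp only [← Matrix.mul_assoc, hDD', one_mul] at this
    have h2 : F v i = (D⁻¹ * E v i * D)ᵀ := by rw [this, Matrix.transpose_transpose]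
    have h3 : (F v i).submatrix (Fin.cast rfl) (Fin.cast rfl) = F v i := rfl
    refine h3.trans ?_
    rw [h2]
    simp only [Matrix.transpose_mul, Matrix.mul_assoc]

end QST
end
end

section
/- Let p ∈ C_q(n,k) be induced by a strategy S = (ψ ∈ ℂ^{d_A} ⊗ ℂ^{d_B}, {E_{v,i}}, {F_{w,j}}), and let ρ_A, ρ_B be the reduced density matrices of ψψ*. Suppose ‖p − p̃‖₁ ≤ δ for some synchronous p̃ ∈ C_q^s(n,k) and some δ ≥ 0. Then for every word W that is a product of ℓ matrices from {E_{v,i}} and every X in the C*-algebra generated by {E_{v,i}} inside M_{d_A}(ℂ) with ‖X‖ ≤ 1, one has |tr((WX − XW)ρ_A)| ≤ 2ℓ√δ; similarly, for every word U that is a product of ℓ matrices from {F_{w,j}} and every Y in the C*-algebra generated by {F_{w,j}} inside M_{d_B}(ℂ) with ‖Y‖ ≤ 1, one has |tr((UY − YU)ρ_B)| ≤ 2ℓ√δ. -/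
open scoped Matrix Kronecker ComplexOrder

noncomputable section
namespace QST

section
variable {H : Type*} [NormedAddCommGroup H] [InnerProductSpace ℂ H] [CompleteSpace H]

theorem clm_mul_app (a b : H →L[ℂ] H) (x : H) : (a * b) x = a (b x) := rfl

theorem core (ψ : H) (hψ : ‖ψ‖ = 1) (s : ℝ) (M : Submonoid (H →L[ℂ] H)) 
    (L : List (H →L[ℂ] H))
    (hL : ∀ e ∈ L, e ∈ M ∧ ‖e‖ ≤ 1 ∧ IsSelfAdjoint e ∧ ∃ f : H →L[ℂ] H, IsSelfAdjoint f ∧ (∀ x ∈ M, f * x = x * f) ∧ ‖e ψ - f ψ‖ ≤ s) :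
    ∀ X ∈ M, ‖X‖ ≤ 1 → ‖inner ℂ ψ ((L.prod * X - X * L.prod) ψ)‖ ≤ 2 * L.length * s := by
  induction L with
  | nil => intro X _ _; simp
  | cons e L ih =>
    intro X hX hX1
    obtain ⟨he, he1, hes, f, hfs, hfc, hf⟩ := hL e (by simp)
    have hL' := fun a (ha : a ∈ L) => hL a (List.mem_cons_of_mem _ ha)
    have ih := ih hL'
    have hs : 0 ≤ s := (norm_nonneg _).trans hf
    have hW : L.prod ∈ M := Submonoid.list_prod_mem _ fun a ha => (hL' a ha).1
    have hW1 : ∀ L : List (H →L[ℂ] H), (∀ a ∈ L, ‖a‖ ≤ 1) → ‖L.prod‖ ≤ 1 := by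
      intro L hL
      induction L with
      | nil => exact ContinuousLinearMap.norm_id_le
      | cons a L ih =>
        rw [List.prod_cons]
        exact (norm_mul_le _ _).trans (mul_le_one₀ (hL a (by simp)) (norm_nonneg _)
          (ih fun b hb => hL b (List.mem_cons_of_mem _ hb)))
    have hW1 := hW1 L fun a ha => (hL' a ha).2.1
    have sa : ∀ g : H →L[ℂ] H, IsSelfAdjoint g → ∀ x y, inner ℂ (g x) y = inner ℂ x (g y) :=
      fun g hg x y => by
        have := ContinuousLinearMap.adjoint_inner_left g y x
        rwa [← ContinuousLinearMap.star_eq_adjoint, hg.star_eq] at this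
    have single : ∀ Z ∈ M, ‖Z‖ ≤ 1 → ‖inner ℂ ψ ((e * Z - Z * e) ψ)‖ ≤ 2 * s := by
      intro Z hZ hZ1
      have key : inner ℂ ψ ((e * Z - Z * e) ψ) =
          inner ℂ (e ψ - f ψ) (Z ψ) - inner ℂ ψ (Z (e ψ - f ψ)) := by
        have h1 : f (Z ψ) = Z (f ψ) := DFunLike.congr_fun (hfc Z hZ) ψ
        simp only [sub_apply, clm_mul_app, inner_sub_right,
          inner_sub_left, map_sub, sa e hes, sa f hfs, h1]
        ring
      rw [key]
      have b : ∀ y, ‖Z y‖ ≤ ‖y‖ := fun y => (Z.le_opNorm y).trans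
        (mul_le_of_le_one_left (norm_nonneg _) hZ1)
      have h1 := norm_inner_le_norm (𝕜 := ℂ) (e ψ - f ψ) (Z ψ)
      have h2 := norm_inner_le_norm (𝕜 := ℂ) ψ (Z (e ψ - f ψ))
      have h3 := norm_sub_le (inner ℂ (e ψ - f ψ) (Z ψ)) (inner ℂ ψ (Z (e ψ - f ψ)))
      have h4 := b ψ
      have h5 := b (e ψ - f ψ)
      rw [hψ] at h2 h4
      nlinarith [norm_nonneg (e ψ - f ψ), norm_nonneg (Z ψ)]
    have e1 := single (L.prod * X) (M.mul_mem hW hX)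
      ((norm_mul_le _ _).trans (mul_le_one₀ hW1 (norm_nonneg _) hX1))
    have e2 := ih (X * e) (M.mul_mem hX he)
      ((norm_mul_le _ _).trans (mul_le_one₀ hX1 (norm_nonneg _) he1))
    have : (e :: L).prod * X - X * (e :: L).prod = (e * (L.prod * X) - (L.prod * X) * e) +
      (L.prod * (X * e) - (X * e) * L.prod) := by rw [List.prod_cons]; noncomm_ring
    rw [this, add_apply, inner_add_right]
    refine (norm_add_le _ _).trans ?_
    rw [List.length_cons, Nat.cast_succ]
    linarith

theorem close {k : ℕ} (ψ : H) (e f : Fin k → H →L[ℂ] H)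
    (he : ∀ i, 0 ≤ e i) (hf : ∀ i, 0 ≤ f i) (hes : ∑ i, e i = 1) (hfs : ∑ i, f i = 1)
    (i : Fin k) (hc : e i * f i = f i * e i) :
    ‖e i ψ - f i ψ‖ ^ 2 ≤ (∑ j ∈ Finset.univ.erase i, (inner ℂ ψ ((e i * f j) ψ)).re)
      + ∑ j ∈ Finset.univ.erase i, (inner ℂ ψ ((e j * f i) ψ)).re := by
  have hsum : ∀ g : Fin k → H →L[ℂ] H, ∑ i, g i = 1 → ∑ j ∈ Finset.univ.erase i, g j = 1 - g i := by
    intro g hg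
    rw [← hg, ← Finset.add_sum_erase _ _ (Finset.mem_univ i)]; simp
  have h1 : (∑ j ∈ Finset.univ.erase i, (inner ℂ ψ ((e i * f j) ψ)).re) =
      (inner ℂ ψ ((e i * (1 - f i)) ψ)).re := by
    rw [← hsum f hfs, Finset.mul_sum, sum_apply, inner_sum, Complex.re_sum]
  have h2 : (∑ j ∈ Finset.univ.erase i, (inner ℂ ψ ((e j * f i) ψ)).re) =
      (inner ℂ ψ (((1 - e i) * f i) ψ)).re := by
    rw [← hsum e hes, Finset.sum_mul, sum_apply, inner_sum, Complex.re_sum]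
  have sq : ∀ g : Fin k → H →L[ℂ] H, (∀ i, 0 ≤ g i) → ∑ i, g i = 1 → 
      0 ≤ (inner ℂ ψ ((g i - g i * g i) ψ)).re := by
    intro g hg hs
    have h0 : 0 ≤ 1 - g i := by rw [← hsum g hs]; exact Finset.sum_nonneg fun j _ => hg j
    have e1 : 0 ≤ g i - g i * g i := by
      have a := IsSelfAdjoint.conjugate_nonneg h0 (IsSelfAdjoint.of_nonneg (hg i))
      have b := IsSelfAdjoint.conjugate_nonneg (hg i) (IsSelfAdjoint.of_nonneg h0)
      convert add_nonneg a b using 1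
      noncomm_ring
    have := ((ContinuousLinearMap.nonneg_iff_isPositive _).1 e1).inner_nonneg_right ψ
    exact (Complex.nonneg_iff.1 this).1
  have key : ‖e i ψ - f i ψ‖ ^ 2 = (inner ℂ ψ (((e i - f i) * (e i - f i)) ψ)).re := by
    have hg : IsSelfAdjoint (e i - f i) := 
      (IsSelfAdjoint.of_nonneg (he i)).sub (IsSelfAdjoint.of_nonneg (hf i))
    rw [clm_mul_app, ← ContinuousLinearMap.adjoint_inner_left, 
      ← ContinuousLinearMap.star_eq_adjoint, hg.star_eq, ← sub_apply]
    exact norm_sq_eq_re_inner (𝕜 := ℂ) _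
  rw [h1, h2, key]
  have t : e i * (1 - f i) + (1 - e i) * f i = (e i - f i) * (e i - f i) + (e i - e i * e i) + (f i - f i * f i) := by
    have : e i * (1 - f i) + (1 - e i) * f i = e i + f i - e i * f i - e i * f i := by noncomm_ring
    rw [this]; nth_rw 2 [hc]; noncomm_ring
  have t2 := congrArg (fun z : H →L[ℂ] H => (inner ℂ ψ (z ψ)).re) t
  simp only [add_apply, inner_add_right, Complex.add_re] at t2
  have := sq e he hes
  have := sq f hf hfs
  linarith

end

def piA (a b : ℕ) : Matrix (Fin a) (Fin a) ℂ →⋆ₐ[ℂ] Matrix (Fin a × Fin b) (Fin a × Fin b) ℂ where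
  toFun M := M ⊗ₖ (1 : Matrix (Fin b) (Fin b) ℂ)
  map_one' := by simp
  map_mul' x y := by rw [← Matrix.mul_kronecker_mul, one_mul]
  map_zero' := by simp
  map_add' x y := by rw [Matrix.add_kronecker]
  commutes' r := by simp [Algebra.algebraMap_eq_smul_one, Matrix.smul_kronecker]
  map_star' x := by simp [Matrix.star_eq_conjTranspose, Matrix.conjTranspose_kronecker]

def piB (a b : ℕ) : Matrix (Fin b) (Fin b) ℂ →⋆ₐ[ℂ] Matrix (Fin a × Fin b) (Fin a × Fin b) ℂ where
  toFun M := (1 : Matrix (Fin a) (Fin a) ℂ) ⊗ₖ M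
  map_one' := by simp
  map_mul' x y := by rw [← Matrix.mul_kronecker_mul, one_mul]
  map_zero' := by simp
  map_add' x y := by rw [Matrix.kronecker_add]
  commutes' r := by simp [Algebra.algebraMap_eq_smul_one, Matrix.kronecker_smul]
  map_star' x := by simp [Matrix.star_eq_conjTranspose, Matrix.conjTranspose_kronecker]

theorem piAB {a b : ℕ} (M : Matrix (Fin a) (Fin a) ℂ) (N : Matrix (Fin b) (Fin b) ℂ) :
    piA a b M * piB a b N = M ⊗ₖ N := by
  change (M ⊗ₖ 1) * (1 ⊗ₖ N) = _
  rw [← Matrix.mul_kronecker_mul, one_mul, mul_one]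
theorem piBA {a b : ℕ} (M : Matrix (Fin a) (Fin a) ℂ) (N : Matrix (Fin b) (Fin b) ℂ) :
    piB a b N * piA a b M = M ⊗ₖ N := by
  change (1 ⊗ₖ N) * (M ⊗ₖ 1) = _
  rw [← Matrix.mul_kronecker_mul, one_mul, mul_one]

abbrev HS (a b : ℕ) := EuclideanSpace ℂ (Fin a × Fin b)

def phA (a b : ℕ) : Matrix (Fin a) (Fin a) ℂ →⋆ₐ[ℂ] (HS a b →L[ℂ] HS a b) :=
  (StarAlgEquiv.toStarAlgHom (Matrix.toEuclideanCLM (𝕜 := ℂ) (n := Fin a × Fin b))).comp (piA a b)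
def phB (a b : ℕ) : Matrix (Fin b) (Fin b) ℂ →⋆ₐ[ℂ] (HS a b →L[ℂ] HS a b) :=
  (StarAlgEquiv.toStarAlgHom (Matrix.toEuclideanCLM (𝕜 := ℂ) (n := Fin a × Fin b))).comp (piB a b)
open scoped MatrixOrder in
theorem ph_nonneg {d : ℕ} {H : Type*} [NormedAddCommGroup H] [InnerProductSpace ℂ H] [CompleteSpace H]
   (φ : Matrix (Fin d) (Fin d) ℂ →⋆ₐ[ℂ] (H →L[ℂ] H)) (E : Matrix (Fin d) (Fin d) ℂ) (hE : E.PosSemidef) : 0 ≤ φ E := by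
  obtain ⟨B, hB⟩ := CStarAlgebra.nonneg_iff_eq_star_mul_self.1 hE.nonneg
  rw [hB, map_mul, map_star]
  exact star_mul_self_nonneg _

theorem ph_norm {d : ℕ} {H : Type*} [NormedAddCommGroup H] [InnerProductSpace ℂ H] [CompleteSpace H]
   (φ : Matrix (Fin d) (Fin d) ℂ →⋆ₐ[ℂ] (H →L[ℂ] H)) (E : Matrix (Fin d) (Fin d) ℂ) :
   ‖φ E‖ ≤ ‖Matrix.toEuclideanCLM (𝕜 := ℂ) E‖ := by
  have := NonUnitalStarAlgHom.norm_apply_le (φ.comp (StarAlgEquiv.toStarAlgHom (Matrix.toEuclideanCLM (𝕜 := ℂ) (n := Fin d)).symm)) (Matrix.toEuclideanCLM (𝕜 := ℂ) E)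
  simpa using this

theorem half {d n k : ℕ} {H : Type*} [NormedAddCommGroup H] [InnerProductSpace ℂ H]
    [CompleteSpace H] (φ : Matrix (Fin d) (Fin d) ℂ →⋆ₐ[ℂ] (H →L[ℂ] H))
    (ψ : H) (hψ : ‖ψ‖ = 1) (δ : ℝ) (E : Fin n → Fin k → Matrix (Fin d) (Fin d) ℂ)
    (hEpos : ∀ v i, (E v i).PosSemidef) (hEsum : ∀ v, ∑ i, E v i = 1)
    (f : Fin n → Fin k → H →L[ℂ] H) (hf : ∀ v i, 0 ≤ f v i) (hfs : ∀ v, ∑ i, f v i = 1)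
    (hc : ∀ v i M, f v i * φ M = φ M * f v i)
    (p : Fin n → Fin n → Fin k → Fin k → ℝ)
    (hp : ∀ v i j, p v v i j = (inner ℂ ψ ((φ (E v i) * f v j) ψ)).re)
    (pt : Fin n → Fin n → Fin k → Fin k → ℝ)
    (hsync : ∀ (v : Fin n) (i j : Fin k), i ≠ j → pt v v i j = 0)
    (hdist : dist1 p pt ≤ δ) (ℓ : ℕ) (L : List (Fin n × Fin k)) (hL : L.length = ℓ)
    (X : Matrix (Fin d) (Fin d) ℂ) (hX : opNorm X ≤ 1) :
    ‖inner ℂ ψ (φ ((L.map fun q => E q.1 q.2).prod * X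
            - X * (L.map fun q => E q.1 q.2).prod) ψ)‖ ≤ 2 * ℓ * Real.sqrt δ := by
  have hes : ∀ v, ∑ i, φ (E v i) = 1 := fun v => by rw [← map_sum, hEsum, map_one]
  have hpos : ∀ v i, 0 ≤ φ (E v i) := fun v i => ph_nonneg φ _ (hEpos v i)
  have := core ψ hψ (Real.sqrt δ) (MonoidHom.mrange (φ : Matrix (Fin d) (Fin d) ℂ →* (H →L[ℂ] H)))
    (L.map fun q => φ (E q.1 q.2)) ?_ (φ X) ⟨X, rfl⟩ ((ph_norm φ X).trans hX)
  · have e : (L.map fun q => φ (E q.1 q.2)).prod = φ (L.map fun q => E q.1 q.2).prod := by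
      rw [map_list_prod, List.map_map]; rfl
    rw [e, List.length_map, hL] at this
    rw [map_sub, map_mul, map_mul]
    exact this
  · intro e he
    obtain ⟨⟨v, i⟩, -, rfl⟩ := List.mem_map.1 he
    refine ⟨⟨_, rfl⟩, ?_, IsSelfAdjoint.of_nonneg (hpos v i), f v i,
      IsSelfAdjoint.of_nonneg (hf v i), ?_, ?_⟩
    · rw [CStarAlgebra.norm_le_one_iff_of_nonneg _ (hpos v i), ← hes v]
      exact Finset.single_le_sum (f := fun i => φ (E v i)) (fun j _ => hpos v j) (Finset.mem_univ i)
    · rintro x ⟨M, rfl⟩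
      exact hc v i M
    · have h := close ψ (fun i => φ (E v i)) (f v) (hpos v) (hf v) (hes v) (hfs v) i
        (hc v i _).symm
      apply Real.le_sqrt_of_sq_le
      refine h.trans (le_trans ?_ hdist)
      simp only [← hp]
      have nn : ∀ w, 0 ≤ ∑ u, ∑ i, ∑ j, |p w u i j - pt w u i j| := fun w => by positivity
      have s1 : (∑ i, ∑ j, |p v v i j - pt v v i j|) ≤ dist1 p pt := by
        unfold dist1
        refine le_trans ?_ (Finset.single_le_sum (f := fun w => ∑ u, ∑ i, ∑ j, |p w u i j - pt w u i j|)
          (fun w _ => nn w) (Finset.mem_univ v))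
        exact (Finset.single_le_sum (f := fun u => ∑ i, ∑ j, |p v u i j - pt v u i j|)
          (fun w _ => by positivity) (Finset.mem_univ v))
      refine le_trans ?_ s1
      rw [← Finset.add_sum_erase _ _ (Finset.mem_univ i)]
      refine add_le_add ?_ ?_
      · refine le_trans ?_ (Finset.sum_le_sum_of_subset_of_nonneg (Finset.erase_subset i _)
          fun _ _ _ => abs_nonneg _)
        refine Finset.sum_le_sum fun j hj => ?_
        rw [hsync v i j (Finset.ne_of_mem_erase hj).symm, sub_zero]
        exact le_abs_self _
      · refine Finset.sum_le_sum fun j hj => ?_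
        refine le_trans ?_ (Finset.single_le_sum (f := fun l => |p v v j l - pt v v j l|)
          (fun _ _ => abs_nonneg _) (Finset.mem_univ i))
        rw [hsync v j i (Finset.ne_of_mem_erase hj), sub_zero]
        exact le_abs_self _

theorem trA {a b : ℕ} (ψ : Fin a × Fin b → ℂ) (M : Matrix (Fin a) (Fin a) ℂ) :
    (M * rhoA ψ).trace = inner ℂ (WithLp.toLp 2 ψ : HS a b) (phA a b M (WithLp.toLp 2 ψ)) := by
  have : phA a b M (WithLp.toLp 2 ψ) = WithLp.toLp 2 ((M ⊗ₖ (1 : Matrix (Fin b) (Fin b) ℂ)) *ᵥ ψ) :=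
    Matrix.toEuclideanCLM_toLp _ _
  rw [this, EuclideanSpace.inner_eq_star_dotProduct]
  simp only [Matrix.trace, Matrix.diag, Matrix.mul_apply, rhoA, Matrix.of_apply, dotProduct,
    Matrix.mulVec, Fintype.sum_prod_type, Matrix.kronecker_apply, Matrix.one_apply, Pi.star_apply,
    mul_ite, ite_mul, mul_one, mul_zero, zero_mul, Finset.sum_ite_eq, Finset.mem_univ, if_true,
    Finset.mul_sum, Finset.sum_mul]
  refine Finset.sum_congr rfl fun x _ => ?_
  rw [Finset.sum_comm]
  refine Finset.sum_congr rfl fun y _ => Finset.sum_congr rfl fun z _ => ?_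
  simp [mul_assoc]

theorem trB {a b : ℕ} (ψ : Fin a × Fin b → ℂ) (M : Matrix (Fin b) (Fin b) ℂ) :
    (M * rhoB ψ).trace = inner ℂ (WithLp.toLp 2 ψ : HS a b) (phB a b M (WithLp.toLp 2 ψ)) := by
  have : phB a b M (WithLp.toLp 2 ψ) = WithLp.toLp 2 (((1 : Matrix (Fin a) (Fin a) ℂ) ⊗ₖ M) *ᵥ ψ) :=
    Matrix.toEuclideanCLM_toLp _ _
  rw [this, EuclideanSpace.inner_eq_star_dotProduct]
  simp only [Matrix.trace, Matrix.diag, Matrix.mul_apply, rhoB, Matrix.of_apply, dotProduct,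
    Matrix.mulVec, Fintype.sum_prod_type_right, Matrix.kronecker_apply, Matrix.one_apply, Pi.star_apply,
    mul_ite, ite_mul, one_mul, mul_zero, zero_mul, Finset.sum_ite_eq, Finset.mem_univ, if_true,
    Finset.mul_sum, Finset.sum_mul]
  refine Finset.sum_congr rfl fun x _ => ?_
  rw [Finset.sum_comm]
  refine Finset.sum_congr rfl fun y _ => Finset.sum_congr rfl fun z _ => ?_
  simp [mul_assoc]

theorem pin {a b : ℕ} (ψ : Fin a × Fin b → ℂ) (M : Matrix (Fin a) (Fin a) ℂ)
    (N : Matrix (Fin b) (Fin b) ℂ) : pinner ((M ⊗ₖ N).mulVec ψ) ψ =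
      inner ℂ (WithLp.toLp 2 ψ : HS a b) ((phA a b M * phB a b N) (WithLp.toLp 2 ψ)) := by
  have : phA a b M * phB a b N = Matrix.toEuclideanCLM (𝕜 := ℂ) (M ⊗ₖ N) := by
    rw [← piAB, map_mul]; rfl
  rw [this, Matrix.toEuclideanCLM_toLp, EuclideanSpace.inner_eq_star_dotProduct]
  rfl

theorem phcomm {a b : ℕ} (M : Matrix (Fin a) (Fin a) ℂ) (N : Matrix (Fin b) (Fin b) ℂ) :
    phA a b M * phB a b N = phB a b N * phA a b M := by
  change Matrix.toEuclideanCLM (𝕜 := ℂ) (piA a b M) * Matrix.toEuclideanCLM (𝕜 := ℂ) (piB a b N) =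
    Matrix.toEuclideanCLM (𝕜 := ℂ) (piB a b N) * Matrix.toEuclideanCLM (𝕜 := ℂ) (piA a b M)
  rw [← map_mul, ← map_mul, piAB, piBA]

theorem dist1_swap {n k : ℕ} (p q : Fin n → Fin n → Fin k → Fin k → ℝ) :
    dist1 (fun v w i j => p w v j i) (fun v w i j => q w v j i) = dist1 p q := by
  unfold dist1
  rw [Finset.sum_comm]
  refine Finset.sum_congr rfl fun _ _ => Finset.sum_congr rfl fun _ _ => Finset.sum_comm

theorem statement2 {n k dA dB : ℕ} (δ : ℝ) (hδ : 0 ≤ δ)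
    (ψ : Fin dA × Fin dB → ℂ)
    (E : Fin n → Fin k → Matrix (Fin dA) (Fin dA) ℂ)
    (F : Fin n → Fin k → Matrix (Fin dB) (Fin dB) ℂ)
    (hψ : evnorm ψ = 1)
    (hEpos : ∀ v i, (E v i).PosSemidef) (hEsum : ∀ v, ∑ i, E v i = 1)
    (hFpos : ∀ w j, (F w j).PosSemidef) (hFsum : ∀ w, ∑ j, F w j = 1)
    (p pt : Fin n → Fin n → Fin k → Fin k → ℝ)
    (hp : ∀ v w i j, (p v w i j : ℂ) = pinner ((E v i ⊗ₖ F w j).mulVec ψ) ψ)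
    (hpt : IsQuantumCorrelation n k pt)
    (hsync : ∀ (v : Fin n) (i j : Fin k), i ≠ j → pt v v i j = 0)
    (hdist : dist1 p pt ≤ δ) :
    (∀ (ℓ : ℕ) (L : List (Fin n × Fin k)), L.length = ℓ →
      ∀ X ∈ StarAlgebra.adjoin ℂ {M | ∃ v i, M = E v i}, opNorm X ≤ 1 →
        ‖((((L.map fun q => E q.1 q.2).prod * X
            - X * (L.map fun q => E q.1 q.2).prod) * rhoA ψ).trace)‖
          ≤ 2 * ℓ * Real.sqrt δ) ∧
    (∀ (ℓ : ℕ) (L : List (Fin n × Fin k)), L.length = ℓ →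
      ∀ Y ∈ StarAlgebra.adjoin ℂ {M | ∃ w j, M = F w j}, opNorm Y ≤ 1 →
        ‖((((L.map fun q => F q.1 q.2).prod * Y
            - Y * (L.map fun q => F q.1 q.2).prod) * rhoB ψ).trace)‖
          ≤ 2 * ℓ * Real.sqrt δ) := by
  have hn : ‖(WithLp.toLp 2 ψ : HS dA dB)‖ = 1 := by
    rw [EuclideanSpace.norm_eq]; exact hψ
  have hre : ∀ v w i j, p v w i j = (inner ℂ (WithLp.toLp 2 ψ : HS dA dB)
      ((phA dA dB (E v i) * phB dA dB (F w j)) (WithLp.toLp 2 ψ))).re := by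
    intro v w i j
    rw [← pin, ← hp, Complex.ofReal_re]
  constructor
  · intro ℓ L hL X _ hX
    rw [trA]
    exact half (phA dA dB) _ hn δ E hEpos hEsum (fun v i => phB dA dB (F v i))
      (fun v i => ph_nonneg _ _ (hFpos v i)) (fun v => by rw [← map_sum, hFsum, map_one])
      (fun v i M => (phcomm _ _).symm) p (fun v i j => hre v v i j) pt hsync hdist ℓ L hL X hX
  · intro ℓ L hL X _ hX
    rw [trB]
    exact half (phB dA dB) _ hn δ F hFpos hFsum (fun v i => phA dA dB (E v i))
      (fun v i => ph_nonneg _ _ (hEpos v i)) (fun v => by rw [← map_sum, hEsum, map_one])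
      (fun v i M => phcomm _ _) (fun v w i j => p w v j i)
      (fun v i j => by rw [← phcomm]; exact hre v v j i) (fun v w i j => pt w v j i)
      (fun v i j h => hsync v j i h.symm) ((dist1_swap p pt).trans_le hdist) ℓ L hL X hX

end QST
end
end

section
/- Let X ∈ M_{d_A}(ℂ), Y ∈ M_{d_B}(ℂ), and ψ ∈ ℂ^{d_A} ⊗ ℂ^{d_B} be such that (X ⊗ I_{d_B})ψ = (I_{d_A} ⊗ Y)ψ. Then supp_A(ψ) is an invariant subspace of X, and supp_B(ψ) is an invariant subspace of Y. -/
open scoped Matrix Kronecker ComplexOrder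

noncomputable section
namespace QST

theorem statement4 {dA dB : ℕ} (X : Matrix (Fin dA) (Fin dA) ℂ)
    (Y : Matrix (Fin dB) (Fin dB) ℂ) (ψ : Fin dA × Fin dB → ℂ)
    (h : (X ⊗ₖ (1 : Matrix (Fin dB) (Fin dB) ℂ)).mulVec ψ
       = ((1 : Matrix (Fin dA) (Fin dA) ℂ) ⊗ₖ Y).mulVec ψ) :
    Submodule.map X.mulVecLin
        (LinearMap.range (Matrix.of fun a b => ψ (a, b)).mulVecLin)
      ≤ LinearMap.range (Matrix.of fun a b => ψ (a, b)).mulVecLin ∧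
    Submodule.map Y.mulVecLin
        (LinearMap.range ((Matrix.of fun a b => ψ (a, b))ᵀ).mulVecLin)
      ≤ LinearMap.range ((Matrix.of fun a b => ψ (a, b))ᵀ).mulVecLin := by
  have key : X * (Matrix.of fun a b => ψ (a, b)) = (Matrix.of fun a b => ψ (a, b)) * Yᵀ := by
    ext a b
    have h1 := congrFun h (a, b)
    simp only [Matrix.mulVec, dotProduct, Fintype.sum_prod_type, Matrix.kroneckerMap_apply,
      Matrix.one_apply, mul_ite, ite_mul, mul_one, one_mul, mul_zero, zero_mul,
      Finset.sum_ite_eq, Finset.mem_univ, if_true] at h1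
    rw [Finset.sum_comm (s := Finset.univ (α := Fin dA)) (f := fun x y =>
      if a = x then Y b y * ψ (x, y) else 0)] at h1
    simp only [Finset.sum_ite_eq, Finset.mem_univ, if_true] at h1
    simp only [Matrix.mul_apply, Matrix.of_apply, Matrix.transpose_apply]
    rw [h1]
    exact Finset.sum_congr rfl fun _ _ => mul_comm _ _
  generalize (Matrix.of fun a b => ψ (a, b)) = D at key ⊢
  have key2 : Y * Dᵀ = Dᵀ * Xᵀ := by
    have := congrArg Matrix.transpose key
    simpa [Matrix.transpose_mul] using this.symm
  constructor
  · rintro _ ⟨_, ⟨v, rfl⟩, rfl⟩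
    exact ⟨Yᵀ.mulVec v, by simp [Matrix.mulVec_mulVec, key]⟩
  · rintro _ ⟨_, ⟨v, rfl⟩, rfl⟩
    exact ⟨Xᵀ.mulVec v, by
      simp only [Matrix.mulVecLin_apply, Matrix.mulVec_mulVec, key2]⟩


end QST
end
end

section
/- Let n ≥ 3 and let x ∈ Λ_n with x = b/d in lowest terms. Then: (i) there exist projections P̃_1, …, P̃_n ∈ M_d(ℂ) with P̃_1 + ⋯ + P̃_n = x·I_d; and (ii) for any such projections P̃_1, …, P̃_n, any k ∈ ℕ, and any projections R_1, …, R_n ∈ M_k(ℂ) with R_1 + ⋯ + R_n = x·I_k, the integer d divides k and there exists a unitary U : ℂ^k → ℂ^d ⊗ ℂ^{k/d} such that U R_v U* = P̃_v ⊗ I_{k/d} for all v ∈ [n]. -/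
open scoped Matrix Kronecker ComplexOrder

noncomputable section
namespace QST

def Rep {α : Type} [Fintype α] [DecidableEq α] {n : ℕ} (x : ℝ)
    (R : Fin n → Matrix α α ℂ) : Prop :=
  (∀ v, (R v)ᴴ = R v ∧ R v * R v = R v) ∧ ∑ v, R v = (x : ℂ) • 1

lemma proj_factor {ι : Type} [Fintype ι] [DecidableEq ι] (Q : Matrix ι ι ℂ)
    (h1 : Qᴴ = Q) (h2 : Q * Q = Q) :
    ∃ k : ℕ, (k : ℂ) = Q.trace ∧ ∃ B : Matrix (Fin k) ι ℂ, B * Bᴴ = 1 ∧ Bᴴ * B = Q := by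
  classical
  have hQ : Q.IsHermitian := h1
  set V : Matrix ι ι ℂ := (hQ.eigenvectorUnitary : Matrix ι ι ℂ) with hV
  have hVV : Vᴴ * V = 1 := by
    have := (Matrix.mem_unitaryGroup_iff'.1 hQ.eigenvectorUnitary.2)
    simpa [Matrix.star_eq_conjTranspose] using this
  have hVV' : V * Vᴴ = 1 := mul_eq_one_comm.1 hVV
  have hsp : Q = V * Matrix.diagonal (fun i => (hQ.eigenvalues i : ℂ)) * Vᴴ := by
    have := hQ.spectral_theorem
    rw [Unitary.conjStarAlgAut_apply] at this
    exact this
  set D := Matrix.diagonal (fun i => (hQ.eigenvalues i : ℂ)) with hD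
  have hDQ : D = Vᴴ * Q * V := by
    rw [hsp]
    calc D = (Vᴴ * V) * D * (Vᴴ * V) := by rw [hVV]; simp
      _ = _ := by simp only [Matrix.mul_assoc]
  have hDD : D * D = D := by
    calc D * D = Vᴴ * Q * (V * Vᴴ) * Q * V := by rw [hDQ]; simp only [Matrix.mul_assoc]
      _ = Vᴴ * (Q * Q) * V := by rw [hVV']; simp only [Matrix.mul_assoc, Matrix.one_mul]
      _ = D := by rw [h2, hDQ]
  have hev : ∀ i, (hQ.eigenvalues i : ℂ) = 0 ∨ (hQ.eigenvalues i : ℂ) = 1 := by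
    intro i
    have := congrFun (congrFun hDD i) i
    rw [hD, Matrix.diagonal_mul_diagonal, Matrix.diagonal_apply_eq, Matrix.diagonal_apply_eq] at this
    have h : (hQ.eigenvalues i : ℂ) * ((hQ.eigenvalues i : ℂ) - 1) = 0 := by
      linear_combination this
    rcases mul_eq_zero.1 h with h | h
    · exact Or.inl h
    · exact Or.inr (sub_eq_zero.1 h)
  set S := {i : ι // (hQ.eigenvalues i : ℂ) = 1} with hS
  let e : S ≃ Fin (Fintype.card S) := Fintype.equivFin S
  have hind : ∀ i, (hQ.eigenvalues i : ℂ) = if (hQ.eigenvalues i : ℂ) = 1 then 1 else 0 := by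
    intro i
    rcases hev i with h | h <;> simp [h]
  refine ⟨Fintype.card S, ?_, Matrix.of fun a j => Vᴴ (e.symm a).1 j, ?_, ?_⟩
  · have : Q.trace = D.trace := by
      rw [hDQ, Matrix.trace_mul_comm, ← Matrix.mul_assoc, hVV', Matrix.one_mul]
    rw [this, hD, Matrix.trace_diagonal, Finset.sum_congr rfl (fun i _ => hind i),
      Finset.sum_boole, Fintype.card_subtype]
  · ext a c
    have := congrFun (congrFun hVV (e.symm a).1) (e.symm c).1
    rw [Matrix.mul_apply] at this
    rw [Matrix.mul_apply]
    simp only [Matrix.conjTranspose_apply, Matrix.of_apply, star_star] at this ⊢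
    rw [this, Matrix.one_apply, Matrix.one_apply]
    congr 1
    rw [Subtype.val_inj, e.symm.injective.eq_iff]
  · ext i j
    rw [Matrix.mul_apply]
    conv_rhs => rw [hsp, Matrix.mul_apply]
    simp only [hD, Matrix.mul_diagonal, Matrix.conjTranspose_apply, Matrix.of_apply, star_star]
    rw [Equiv.sum_comp e.symm (fun s : S => V i s.1 * star (V j s.1))]
    have h3 : ∀ x, V i x * (hQ.eigenvalues x : ℂ) * star (V j x) =
        if (hQ.eigenvalues x : ℂ) = 1 then V i x * star (V j x) else 0 := by
      intro x
      rcases hev x with h | h <;> simp [h]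
    rw [Finset.sum_congr rfl (fun x _ => h3 x), ← Finset.sum_filter]
    symm
    apply Finset.sum_subtype
    simp

lemma cr_eq {α β : Type} [Fintype α] [DecidableEq α] [Fintype β]
    (C : Matrix β α ℂ) (R : Matrix α α ℂ) (h : Cᴴ * C = R) (h1 : Rᴴ = R) (h2 : R * R = R) :
    C * R = C := by
  have h0 : (C * R - C)ᴴ * (C * R - C) = 0 := by
    rw [Matrix.conjTranspose_sub, Matrix.conjTranspose_mul, h1, Matrix.sub_mul, Matrix.mul_sub,
      Matrix.mul_sub]
    have e1 : R * Cᴴ * (C * R) = R := by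
      rw [← Matrix.mul_assoc, Matrix.mul_assoc R, h, h2, h2]
    have e2 : R * Cᴴ * C = R := by rw [Matrix.mul_assoc, h, h2]
    have e3 : Cᴴ * (C * R) = R := by rw [← Matrix.mul_assoc, h, h2]
    rw [e1, e2, e3, h]; simp
  exact sub_eq_zero.1 (Matrix.conjTranspose_mul_self_eq_zero.1 h0)

lemma hyp {α : Type} [Fintype α] [DecidableEq α] {n : ℕ} (y : ℝ) (hy : 1 < y)
    (R : Fin n → Matrix α α ℂ) (hR : Rep y R) :
    ∃ k : ℕ, (k : ℝ) = (y - 1) * Fintype.card α ∧ ∃ C : Fin n → Matrix (Fin k) α ℂ,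
      (∀ v, (C v)ᴴ * C v = R v) ∧ (∑ v, C v * (C v)ᴴ = ((y / (y - 1) : ℝ) : ℂ) • 1) ∧
      ∀ v w, v ≠ w → R v * R w = (-(y - 1) : ℂ) • ((C v)ᴴ * C w) := by
  obtain ⟨hR1, hR2⟩ := hR
  have hy0 : (y : ℂ) ≠ 0 := by
    have : y ≠ 0 := by linarith
    exact_mod_cast this
  have hy1 : (y : ℂ) - 1 ≠ 0 := by
    have : y - 1 ≠ 0 := by linarith
    exact_mod_cast this
  let A : Matrix α (α × Fin n) ℂ := Matrix.of fun i p => R p.2 i p.1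
  let D : Matrix (α × Fin n) (α × Fin n) ℂ := Matrix.blockDiagonal R
  have hRs : ∀ v i j, star (R v i j) = R v j i := by
    intro v i j
    conv_rhs => rw [← (hR1 v).1]
    rfl
  have hAA : A * Aᴴ = (y : ℂ) • 1 := by
    rw [← hR2]
    ext i j
    rw [Matrix.mul_apply, Fintype.sum_prod_type_right, Matrix.sum_apply]
    refine Finset.sum_congr rfl fun v _ => ?_
    conv_rhs => rw [← (hR1 v).2]
    rw [Matrix.mul_apply]
    simp [A, Matrix.conjTranspose_apply, hRs]
  have hDD : D * D = D := by
    simp only [D]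
    rw [← Matrix.blockDiagonal_mul]
    congr 1
    ext1 v
    exact (hR1 v).2
  have hDh : Dᴴ = D := by
    simp only [D]
    rw [Matrix.blockDiagonal_conjTranspose]
    congr 1
    ext1 v
    exact (hR1 v).1
  have hAD : A * D = A := by
    ext i ⟨j, v⟩
    have := congrFun (congrFun (hR1 v).2 i) j
    rw [Matrix.mul_apply] at this
    rw [Matrix.mul_apply, Fintype.sum_prod_type_right]
    simp only [A, D, Matrix.of_apply, Matrix.blockDiagonal_apply]
    rw [Finset.sum_eq_single v]
    · simpa using this
    · intro w _ hw
      simp [hw]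
    · simp
  have hDA : D * Aᴴ = Aᴴ := by
    have := congrArg Matrix.conjTranspose hAD
    rwa [Matrix.conjTranspose_mul, hDh] at this
  let Q := D - (y : ℂ)⁻¹ • (Aᴴ * A)
  have hQh : Qᴴ = Q := by
    simp [Q, Matrix.conjTranspose_sub, Matrix.conjTranspose_smul, hDh]
  have hQQ : Q * Q = Q := by
    simp only [Q, Matrix.sub_mul, Matrix.mul_sub, hDD, Matrix.smul_mul, Matrix.mul_smul]
    have e1 : Aᴴ * A * D = Aᴴ * A := by rw [Matrix.mul_assoc, hAD]
    have e2 : D * (Aᴴ * A) = Aᴴ * A := by rw [← Matrix.mul_assoc, hDA]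
    have e3 : Aᴴ * A * (Aᴴ * A) = (y : ℂ) • (Aᴴ * A) := by
      rw [Matrix.mul_assoc, ← Matrix.mul_assoc A, hAA]; simp
    rw [e1, e2, e3, smul_smul, inv_mul_cancel₀ hy0]; simp
  obtain ⟨k, hk, B, hB1, hB2⟩ := proj_factor Q hQh hQQ
  have htr : Q.trace = ((y : ℂ) - 1) * Fintype.card α := by
    simp only [Q, Matrix.trace_sub, Matrix.trace_smul]
    rw [Matrix.trace_mul_comm, hAA, Matrix.trace_blockDiagonal, ← Matrix.trace_sum, hR2]
    simp only [Matrix.trace_smul, Matrix.trace_one, smul_eq_mul]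
    field_simp
  let s : ℝ := Real.sqrt (y / (y - 1))
  have hs : (s : ℂ) * s = (y : ℂ) / (y - 1) := by
    have : s * s = y / (y - 1) := Real.mul_self_sqrt (div_nonneg (by linarith) (by linarith))
    exact_mod_cast this
  have hent : ∀ v w i j, ∑ a, star (B a (i, v)) * B a (j, w) =
      (if v = w then R v i j else 0) - (y : ℂ)⁻¹ * (R v * R w) i j := by
    intro v w i j
    have := congrFun (congrFun hB2 (i, v)) (j, w)
    rw [Matrix.mul_apply] at this
    simp only [Matrix.conjTranspose_apply] at this
    rw [this]
    simp [Q, D, A, Matrix.blockDiagonal_apply, Matrix.mul_apply, Matrix.conjTranspose_apply, hRs]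
  let C : Fin n → Matrix (Fin k) α ℂ := fun v => Matrix.of fun a i => (s : ℂ) * B a (i, v)
  have hCC : ∀ v w i j, ((C v)ᴴ * C w) i j =
      (y : ℂ) / (y - 1) * ((if v = w then R v i j else 0) - (y : ℂ)⁻¹ * (R v * R w) i j) := by
    intro v w i j
    rw [← hent, ← hs, Matrix.mul_apply, Finset.mul_sum]
    refine Finset.sum_congr rfl fun a _ => ?_
    simp [C, Matrix.conjTranspose_apply]
    ring
  refine ⟨k, ?_, C, ?_, ?_, ?_⟩
  · rw [htr] at hk
    exact_mod_cast hk
  · intro v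
    ext i j
    rw [hCC, (hR1 v).2, if_pos rfl]
    field_simp
  · ext a c
    have := congrFun (congrFun hB1 a) c
    rw [Matrix.mul_apply, Fintype.sum_prod_type_right] at this
    rw [Matrix.smul_apply, ← this, Matrix.sum_apply, smul_eq_mul, Finset.mul_sum]
    refine Finset.sum_congr rfl fun v _ => ?_
    rw [Matrix.mul_apply, Finset.mul_sum]
    refine Finset.sum_congr rfl fun i _ => ?_
    push_cast
    rw [← hs]
    simp [C, Matrix.conjTranspose_apply]
    ring
  · intro v w hvw
    ext i j
    rw [Matrix.smul_apply, hCC, if_neg hvw, smul_eq_mul]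
    field_simp
    ring

lemma hyp_rep {α : Type} [Fintype α] [DecidableEq α] {n k : ℕ} (x : ℝ)
    (R : Fin n → Matrix α α ℂ) (hR : ∀ v, (R v)ᴴ = R v ∧ R v * R v = R v)
    (C : Fin n → Matrix (Fin k) α ℂ)
    (h1 : ∀ v, (C v)ᴴ * C v = R v) (h2 : ∑ v, C v * (C v)ᴴ = (x : ℂ) • 1) :
    Rep x (fun v => C v * (C v)ᴴ) := by
  refine ⟨fun v => ⟨?_, ?_⟩, h2⟩
  · simp
  · have := cr_eq (C v) (R v) (h1 v) (hR v).1 (hR v).2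
    calc C v * (C v)ᴴ * (C v * (C v)ᴴ) = C v * ((C v)ᴴ * C v) * (C v)ᴴ := by
          simp only [Matrix.mul_assoc]
      _ = _ := by rw [h1, this]

lemma refl_rep {α : Type} [Fintype α] [DecidableEq α] {n : ℕ} (x : ℝ)
    (R : Fin n → Matrix α α ℂ) (hR : Rep x R) : Rep (n - x) (fun v => 1 - R v) := by
  refine ⟨fun v => ⟨?_, ?_⟩, ?_⟩
  · simp [(hR.1 v).1]
  · simp [Matrix.sub_mul, Matrix.mul_sub, (hR.1 v).2]
  · rw [Finset.sum_sub_distrib, hR.2]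
    simp [sub_smul]
    ext i j
    simp [Matrix.smul_apply, Matrix.natCast_apply, Matrix.one_apply]

/-- uniqueness in every dimension -/
def Uniq (n : ℕ) (x : ℝ) : Prop :=
  ∀ (m : ℕ) (R R' : Fin n → Matrix (Fin m) (Fin m) ℂ), Rep x R → Rep x R' →
    ∃ U : Matrix (Fin m) (Fin m) ℂ, Uᴴ * U = 1 ∧ U * Uᴴ = 1 ∧ ∀ v, U * R v * Uᴴ = R' v

lemma uniq_refl (n : ℕ) (x : ℝ) (h : Uniq n x) : Uniq n (n - x) := by
  intro m R R' hR hR'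
  have a1 := refl_rep _ _ hR
  have a2 := refl_rep _ _ hR'
  rw [sub_sub_cancel] at a1 a2
  obtain ⟨U, h1, h2, h3⟩ := h m _ _ a1 a2
  refine ⟨U, h1, h2, fun v => ?_⟩
  have := h3 v
  rw [Matrix.mul_sub, Matrix.sub_mul, Matrix.mul_one, h2] at this
  exact sub_right_injective this

lemma uniq_hyp (n : ℕ) (x : ℝ) (hx : 1 < x) (h : Uniq n (x / (x - 1))) : Uniq n x := by
  intro m R R' hR hR'
  obtain ⟨k, hk, C, c1, c2, c3⟩ := hyp x hx R hR
  obtain ⟨k', hk', C', c1', c2', c3'⟩ := hyp x hx R' hR'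
  have hkk : k' = k := by
    rw [← hk] at hk'; exact_mod_cast hk'
  subst hkk
  obtain ⟨W, w1, w2, w3⟩ := h _ _ _ (hyp_rep _ R hR.1 C c1 c2) (hyp_rep _ R' hR'.1 C' c1' c2')
  have hx0 : (x : ℂ) ≠ 0 := by
    have : x ≠ 0 := by linarith
    exact_mod_cast this
  have cr : ∀ v, C v * R v = C v := fun v => cr_eq _ _ (c1 v) (hR.1 v).1 (hR.1 v).2
  have cr' : ∀ v, C' v * R' v = C' v := fun v => cr_eq _ _ (c1' v) (hR'.1 v).1 (hR'.1 v).2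
  have rc' : ∀ v, R' v * (C' v)ᴴ = (C' v)ᴴ := by
    intro v
    have := congrArg Matrix.conjTranspose (cr' v)
    rwa [Matrix.conjTranspose_mul, (hR'.1 v).1] at this
  have rc : ∀ v, R v * (C v)ᴴ = (C v)ᴴ := by
    intro v
    have := congrArg Matrix.conjTranspose (cr v)
    rwa [Matrix.conjTranspose_mul, (hR.1 v).1] at this
  have w4 : ∀ v, Wᴴ * (C' v * (C' v)ᴴ) * W = C v * (C v)ᴴ := by
    intro v
    rw [← w3 v]
    calc Wᴴ * (W * (C v * (C v)ᴴ) * Wᴴ) * W = (Wᴴ * W) * (C v * (C v)ᴴ) * (Wᴴ * W) := by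
          simp only [Matrix.mul_assoc]
      _ = _ := by rw [w1]; simp
  let Z : Fin n → Matrix (Fin m) (Fin m) ℂ := fun v => (C' v)ᴴ * W * C v
  have hZh : ∀ v, (Z v)ᴴ = (C v)ᴴ * Wᴴ * C' v := by
    intro v; simp [Z, Matrix.mul_assoc]
  have z1 : ∀ v, Z v * (Z v)ᴴ = R' v := by
    intro v
    rw [hZh]
    calc (C' v)ᴴ * W * C v * ((C v)ᴴ * Wᴴ * C' v)
        = (C' v)ᴴ * (W * (C v * (C v)ᴴ) * Wᴴ) * C' v := by simp only [Matrix.mul_assoc]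
      _ = ((C' v)ᴴ * C' v) * ((C' v)ᴴ * C' v) := by rw [w3]; simp only [Matrix.mul_assoc]
      _ = R' v := by rw [c1', (hR'.1 v).2]
  have z3 : ∀ v, Z v * R v = Z v := by
    intro v; simp only [Z]; rw [Matrix.mul_assoc, cr]
  have z4 : ∀ v, R' v * Z v = Z v := by
    intro v; simp only [Z]; rw [← Matrix.mul_assoc, ← Matrix.mul_assoc, rc']
  have z4' : ∀ v, (Z v)ᴴ * R' v = (Z v)ᴴ := by
    intro v
    rw [hZh, Matrix.mul_assoc, cr']
  have z3' : ∀ v, R v * (Z v)ᴴ = (Z v)ᴴ := by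
    intro v
    rw [hZh, ← Matrix.mul_assoc, ← Matrix.mul_assoc, rc]
  have z2 : ∀ v w, (Z v)ᴴ * Z w = R v * R w := by
    intro v w
    by_cases hvw : v = w
    · subst hvw
      rw [hZh]
      calc (C v)ᴴ * Wᴴ * C' v * ((C' v)ᴴ * W * C v)
          = (C v)ᴴ * (Wᴴ * (C' v * (C' v)ᴴ) * W) * C v := by simp only [Matrix.mul_assoc]
        _ = ((C v)ᴴ * C v) * ((C v)ᴴ * C v) := by rw [w4]; simp only [Matrix.mul_assoc]
        _ = _ := by rw [c1]
    · have e : (Z v)ᴴ * ((C' v)ᴴ * C' w) * Z w = (C v)ᴴ * C w := by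
        rw [hZh]
        calc (C v)ᴴ * Wᴴ * C' v * ((C' v)ᴴ * C' w) * ((C' w)ᴴ * W * C w)
            = (C v)ᴴ * (Wᴴ * (C' v * (C' v)ᴴ) * 1 * (C' w * (C' w)ᴴ) * W) * C w := by
              simp only [Matrix.mul_assoc, Matrix.one_mul]
          _ = (C v)ᴴ * ((Wᴴ * (C' v * (C' v)ᴴ) * W) * (Wᴴ * (C' w * (C' w)ᴴ) * W)) * C w := by
              rw [← w2]; simp only [Matrix.mul_assoc]
          _ = ((C v)ᴴ * C v) * (C v)ᴴ * (C w * ((C w)ᴴ * C w)) := by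
              rw [w4, w4]; simp only [Matrix.mul_assoc]
          _ = _ := by rw [c1, c1, rc, cr]
      calc (Z v)ᴴ * Z w = (Z v)ᴴ * (R' v * R' w) * Z w := by
            rw [← Matrix.mul_assoc (Z v)ᴴ (R' v) (R' w), z4', Matrix.mul_assoc (Z v)ᴴ (R' w) (Z w), z4]
        _ = R v * R w := by
            rw [c3' v w hvw, c3 v w hvw, Matrix.mul_smul, Matrix.smul_mul, e]
  let U : Matrix (Fin m) (Fin m) ℂ := (x : ℂ)⁻¹ • ∑ v, Z v
  have hUh : Uᴴ = (x : ℂ)⁻¹ • ∑ v, (Z v)ᴴ := by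
    simp [U, Matrix.conjTranspose_smul, Matrix.conjTranspose_sum]
  have u1 : ∀ w, U * R w = Z w := by
    intro w
    simp only [U]
    rw [Matrix.smul_mul, Matrix.sum_mul]
    have : ∀ v, Z v * R w = R' v * Z w := by
      intro v
      rw [← z3 v, Matrix.mul_assoc, ← z2, ← Matrix.mul_assoc, z1]
    rw [Finset.sum_congr rfl (fun v _ => this v), ← Matrix.sum_mul, hR'.2, Matrix.smul_mul,
      smul_smul, inv_mul_cancel₀ hx0]
    simp
  have u2 : U * Uᴴ = 1 := by
    rw [hUh, Matrix.mul_smul, Matrix.mul_sum]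
    have : ∀ w, U * (Z w)ᴴ = R' w := by
      intro w
      rw [← z3', ← Matrix.mul_assoc, u1, z1]
    rw [Finset.sum_congr rfl (fun v _ => this v), hR'.2, smul_smul, inv_mul_cancel₀ hx0, one_smul]
  refine ⟨U, mul_eq_one_comm.1 u2, u2, fun v => ?_⟩
  calc U * R v * Uᴴ = (U * R v) * (U * R v)ᴴ := by
        rw [Matrix.conjTranspose_mul, (hR.1 v).1, ← Matrix.mul_assoc, Matrix.mul_assoc U (R v) (R v),
          (hR.1 v).2]
    _ = R' v := by rw [u1, z1]

lemma uniq_zero (n : ℕ) : Uniq n 0 := by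
  intro m R R' hR hR'
  have key : ∀ R : Fin n → Matrix (Fin m) (Fin m) ℂ, Rep 0 R → ∀ v, R v = 0 := by
    intro R hR v
    have hp : ∀ v, (R v).PosSemidef := by
      intro v
      have := Matrix.posSemidef_conjTranspose_mul_self (R v)
      rwa [(hR.1 v).1, (hR.1 v).2] at this
    have h0 : ∑ v, (R v).trace = 0 := by
      rw [← Matrix.trace_sum, hR.2]; simp
    have := (Finset.sum_eq_zero_iff_of_nonneg (fun v _ => (hp v).trace_nonneg)).1 h0 v
      (Finset.mem_univ v)
    exact (hp v).trace_eq_zero_iff.1 this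
  refine ⟨1, by simp, by simp, fun v => ?_⟩
  rw [key R hR, key R' hR']; simp

lemma uniq_step (n : ℕ) (x : ℝ) (hx : x < n - 1) (h : Uniq n x) :
    Uniq n (1 + 1 / ((n : ℝ) - 1 - x)) := by
  have h0 : 0 < (n : ℝ) - 1 - x := by linarith
  apply uniq_hyp
  · have : 0 < 1 / ((n : ℝ) - 1 - x) := by positivity
    linarith
  · have : (1 + 1 / ((n : ℝ) - 1 - x)) / (1 + 1 / ((n : ℝ) - 1 - x) - 1) = n - x := by
      have := h0.ne'
      field_simp
      ring
    rw [this]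
    exact uniq_refl _ _ h

def Ex (n : ℕ) (x : ℝ) : Prop :=
  ∃ b d : ℕ, 0 < d ∧ Nat.Coprime b d ∧ x = (b : ℝ) / d ∧
    ∃ P : Fin n → Matrix (Fin d) (Fin d) ℂ, Rep x P

lemma ex_zero (n : ℕ) : Ex n 0 := by
  refine ⟨0, 1, by simp, by simp, by simp, fun _ => 0, ?_, ?_⟩
  · simp
  · simp

lemma ex_step (n : ℕ) (x : ℝ) (hx : x < n - 1) (h : Ex n x) :
    Ex n (1 + 1 / ((n : ℝ) - 1 - x)) := by
  obtain ⟨b, d, hd, hbd, hxe, P, hP⟩ := h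
  have h0 : 0 < (n : ℝ) - 1 - x := by linarith
  have hdR : (0 : ℝ) < d := by exact_mod_cast hd
  have hy : 1 < (n : ℝ) - x := by linarith
  obtain ⟨k, hk, C, c1, c2, -⟩ := hyp _ hy _ (refl_rep x P hP)
  have hrep := hyp_rep _ _ (refl_rep x P hP).1 C c1 c2
  have hxd : x * d = b := by rw [hxe]; field_simp
  have hk2 : (k : ℝ) = ((n : ℝ) - x - 1) * d := by simpa using hk
  have hkR : (0 : ℝ) < k := by
    rw [hk2]; apply mul_pos <;> linarith
  have hkb : k + b + d = n * d := by
    have : (k : ℝ) + b + d = n * d := by rw [hk2, ← hxd]; ring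
    exact_mod_cast this
  refine ⟨k + d, k, by exact_mod_cast hkR, ?_, ?_, fun v => C v * (C v)ᴴ, ?_⟩
  · -- coprime
    have hc : Nat.Coprime d k := by
      apply Nat.Coprime.symm
      rw [Nat.coprime_iff_gcd_eq_one]
      apply Nat.eq_one_of_dvd_one
      have g1 := Nat.gcd_dvd_left k d
      have g2 := Nat.gcd_dvd_right k d
      have g3 : k.gcd d ∣ b := by
        have h1 : k.gcd d ∣ (k + d) + b := by
          have : (k + d) + b = n * d := by omega
          rw [this]; exact Dvd.dvd.mul_left g2 n
        exact (Nat.dvd_add_right (dvd_add g1 g2)).1 h1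
      have := Nat.dvd_gcd g3 g2
      rwa [hbd] at this
    simpa using hc
  · push_cast
    rw [hk2]
    have := h0.ne'
    have h5 : (n : ℝ) - x - 1 ≠ 0 := by linarith
    field_simp
    ring
  · have : 1 + 1 / ((n : ℝ) - 1 - x) = ((n : ℝ) - x) / ((n : ℝ) - x - 1) := by
      have := h0.ne'
      have h5 : (n : ℝ) - x - 1 ≠ 0 := by linarith
      field_simp
      ring
    rw [this]
    exact hrep

lemma main_lambda (n : ℕ) (hn : 3 ≤ n) (x : ℝ) (hx : x ∈ Lambda n) : Uniq n x ∧ Ex n x := by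
  unfold Lambda at hx
  split_ifs at hx with h3
  · subst h3
    have : x = 1 + 1 / (((3 : ℕ) : ℝ) - 1 - 0) := by
      rw [Set.mem_singleton_iff.1 hx]; norm_num
    rw [this]
    exact ⟨uniq_step 3 0 (by norm_num) (uniq_zero 3), ex_step 3 0 (by norm_num) (ex_zero 3)⟩
  · obtain ⟨l, rfl⟩ := hx
    have hn4 : (4 : ℝ) ≤ n := by
      have : 4 ≤ n := by omega
      exact_mod_cast this
    have : lambdaSeq n l ≤ 2 ∧ Uniq n (lambdaSeq n l) ∧ Ex n (lambdaSeq n l) := by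
      induction l with
      | zero => exact ⟨by simp [lambdaSeq], uniq_zero n, ex_zero n⟩
      | succ l ih =>
        obtain ⟨i1, i2, i3⟩ := ih
        refine ⟨?_, uniq_step n _ (by linarith) i2, ex_step n _ (by linarith) i3⟩
        have h1 : 1 ≤ (n : ℝ) - 1 - lambdaSeq n l := by linarith
        have : 1 / ((n : ℝ) - 1 - lambdaSeq n l) ≤ 1 := by
          rw [div_le_one (by linarith)]; exact h1
        simp only [lambdaSeq]
        linarith
    exact this.2

lemma dvd_dim {n b d m : ℕ} (x : ℝ) (hd : 0 < d) (hcop : Nat.Coprime b d)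
    (hbd : x = (b : ℝ) / d) (R : Fin n → Matrix (Fin m) (Fin m) ℂ) (hR : Rep x R) : d ∣ m := by
  choose r hr _ using fun v => proj_factor (R v) (hR.1 v).1 (hR.1 v).2
  have h1 : ((∑ v, r v : ℕ) : ℂ) = x * m := by
    push_cast
    rw [Finset.sum_congr rfl (fun v _ => hr v), ← Matrix.trace_sum, hR.2]
    simp
  have h2 : ((∑ v, r v : ℕ) : ℝ) = x * m := by exact_mod_cast h1
  have hdR : (d : ℝ) ≠ 0 := by exact_mod_cast hd.ne'
  have h3 : d * (∑ v, r v) = b * m := by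
    have : (d : ℝ) * ((∑ v, r v : ℕ) : ℝ) = b * m := by
      rw [h2, hbd]; field_simp
    exact_mod_cast this
  exact hcop.symm.dvd_of_dvd_mul_left (Dvd.intro _ h3)

theorem statement6 {n b d : ℕ} (hn : 3 ≤ n) (x : ℝ) (hx : x ∈ Lambda n)
    (hd : 0 < d) (hcop : Nat.Coprime b d) (hbd : x = (b : ℝ) / d) :
    (∃ P : Fin n → Matrix (Fin d) (Fin d) ℂ,
      (∀ v, IsProjection (P v)) ∧ ∑ v, P v = (x : ℂ) • 1) ∧
    ∀ P : Fin n → Matrix (Fin d) (Fin d) ℂ,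
      (∀ v, IsProjection (P v)) → ∑ v, P v = (x : ℂ) • 1 →
      ∀ (m : ℕ) (R : Fin n → Matrix (Fin m) (Fin m) ℂ),
        (∀ v, IsProjection (R v)) → ∑ v, R v = (x : ℂ) • 1 →
        d ∣ m ∧ ∃ U : Matrix (Fin d × Fin (m / d)) (Fin m) ℂ,
          Uᴴ * U = 1 ∧ U * Uᴴ = 1 ∧
          ∀ v, U * R v * Uᴴ = P v ⊗ₖ (1 : Matrix (Fin (m / d)) (Fin (m / d)) ℂ) := by
  obtain ⟨hU, b', d', hd', hcop', hbd', P0, hP0⟩ := main_lambda n hn x hx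
  have hdd : d' = d := by
    have e : (b : ℝ) * d' = b' * d := by
      have h1 : (d : ℝ) ≠ 0 := by exact_mod_cast hd.ne'
      have h2 : (d' : ℝ) ≠ 0 := by exact_mod_cast hd'.ne'
      rw [hbd] at hbd'
      field_simp at hbd'
      linarith
    have e' : b * d' = b' * d := by exact_mod_cast e
    apply Nat.dvd_antisymm
    · exact hcop'.symm.dvd_of_dvd_mul_left (Dvd.intro_left _ e')
    · exact hcop.symm.dvd_of_dvd_mul_left (Dvd.intro_left _ e'.symm)
  subst hdd
  refine ⟨⟨P0, hP0.1, hP0.2⟩, ?_⟩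
  intro P hP hPs m R hR hRs
  have hdvd : d' ∣ m := dvd_dim x hd hcop hbd R ⟨hR, hRs⟩
  refine ⟨hdvd, ?_⟩
  let e : Fin m ≃ Fin d' × Fin (m / d') :=
    (finCongr (Nat.mul_div_cancel' hdvd).symm).trans finProdFinEquiv.symm
  let P' : Fin n → Matrix (Fin m) (Fin m) ℂ := fun v =>
    (P v ⊗ₖ (1 : Matrix (Fin (m / d')) (Fin (m / d')) ℂ)).submatrix e e
  have hP' : Rep x P' := by
    refine ⟨fun v => ⟨?_, ?_⟩, ?_⟩
    · simp only [P']
      rw [Matrix.conjTranspose_submatrix, Matrix.conjTranspose_kronecker, (hP v).1,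
        Matrix.conjTranspose_one]
    · simp only [P']
      rw [Matrix.submatrix_mul_equiv, ← Matrix.mul_kronecker_mul, (hP v).2, Matrix.one_mul]
    · have : ∑ v, P' v =
          ((∑ v, P v) ⊗ₖ (1 : Matrix (Fin (m / d')) (Fin (m / d')) ℂ)).submatrix e e := by
        ext i j
        simp [P', Matrix.sum_apply, Matrix.kroneckerMap_apply, Finset.sum_mul]
      rw [this, hPs, Matrix.smul_kronecker, Matrix.one_kronecker_one, Matrix.submatrix_smul]
      simp
  obtain ⟨U, u1, u2, u3⟩ := hU m R P' ⟨hR, hRs⟩ hP'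
  have hUe : (U.submatrix e.symm id)ᴴ = Uᴴ.submatrix id e.symm := by
    rw [Matrix.conjTranspose_submatrix]
  refine ⟨U.submatrix e.symm id, ?_, ?_, fun v => ?_⟩
  · rw [hUe, Matrix.submatrix_mul_equiv, u1]; simp
  · rw [hUe, ← Matrix.submatrix_mul _ _ _ _ _ Function.bijective_id, u2]; simp
  · have h1 : U.submatrix e.symm id * R v = (U * R v).submatrix e.symm id := by
      rw [Matrix.submatrix_mul _ _ _ _ _ Function.bijective_id]; simp
    rw [hUe, h1, ← Matrix.submatrix_mul _ _ _ _ _ Function.bijective_id, u3]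
    simp [P']

end QST
end
end

section
/- Let n ≥ 3 and let x ∈ Λ_n with x = b/d in lowest terms. If R_1, …, R_n ∈ M_d(ℂ) are projections such that R_1 + ⋯ + R_n = x·I_d, then the star-subalgebra of M_d(ℂ) generated by {R_1, …, R_n} is all of M_d(ℂ). -/
open scoped Matrix Kronecker ComplexOrder

noncomputable section
namespace QST

theorem trace_aux {V : Type*} [AddCommGroup V] [Module ℂ V] [FiniteDimensional ℂ V]
    {n b d : ℕ} (hd : 0 < d) (hcop : Nat.Coprime b d)
    (T : Fin n → Module.End ℂ V) (hT : ∀ v, IsIdempotentElem (T v))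
    (hsum : ∑ v, T v = ((b : ℂ) / d) • 1) : d ∣ Module.finrank ℂ V := by
  have h := congrArg (LinearMap.trace ℂ V) hsum
  rw [map_sum, map_smul, LinearMap.trace_one] at h
  simp_rw [fun v => (LinearMap.IsIdempotentElem.isProj_range _ (hT v)).trace] at h
  have hd' : (d : ℂ) ≠ 0 := by exact_mod_cast hd.ne'
  rw [smul_eq_mul, div_mul_eq_mul_div, eq_div_iff hd'] at h
  have h2 : (∑ v, Module.finrank ℂ (LinearMap.range (T v))) * d = b * Module.finrank ℂ V := by
    exact_mod_cast h
  exact hcop.symm.dvd_of_dvd_mul_left ⟨_, by rw [← h2, mul_comm]⟩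

theorem burnside_aux {V : Type*} [AddCommGroup V] [Module ℂ V] [FiniteDimensional ℂ V]
    [Nontrivial V] (A : Subalgebra ℂ (Module.End ℂ V))
    (h : ∀ W : Submodule ℂ V, (∀ a ∈ A, ∀ w ∈ W, a w ∈ W) → W = ⊥ ∨ W = ⊤) : A = ⊤ := by
  haveI : IsSimpleModule A V := by
    rw [isSimpleModule_iff]
    refine { exists_pair_ne := ⟨⊥, ⊤, bot_ne_top⟩, eq_bot_or_eq_top := fun W => ?_ }
    rcases h (W.restrictScalars ℂ) (fun a ha w hw => W.smul_mem (⟨a, ha⟩ : A) hw) with h | h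
    · left; simpa using h
    · right; simpa using h
  have hb := (IsSimpleModule.algebraMap_end_bijective_of_isAlgClosed (A := A) (V := V) ℂ).2
  rw [eq_top_iff]
  intro f _
  let F : Module.End (Module.End A V) V :=
    { toFun := f
      map_add' := map_add f
      map_smul' := fun c x => by
        obtain ⟨t, rfl⟩ := hb c
        simp }
  obtain ⟨s, hs⟩ := Module.Finite.fg_top (R := ℂ) (M := V)
  obtain ⟨r, hr⟩ := jacobson_density (R := A) F s
  have : f = r.1 := LinearMap.ext_on (s := (s : Set V)) hs (fun m hm => hr m hm)
  rw [this]; exact r.2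

theorem statement7 {n b d : ℕ} (hn : 3 ≤ n) (x : ℝ) (hx : x ∈ Lambda n)
    (hd : 0 < d) (hcop : Nat.Coprime b d) (hbd : x = (b : ℝ) / d)
    (R : Fin n → Matrix (Fin d) (Fin d) ℂ)
    (hproj : ∀ v, IsProjection (R v)) (hsum : ∑ v, R v = (x : ℂ) • 1) :
    StarAlgebra.adjoin ℂ (Set.range R) = ⊤ := by
  haveI : Nonempty (Fin d) := ⟨⟨0, hd⟩⟩
  set S := StarAlgebra.adjoin ℂ (Set.range R) with hS
  let φ : Matrix (Fin d) (Fin d) ℂ ≃ₐ[ℂ] Module.End ℂ (Fin d → ℂ) := Matrix.toLinAlgEquiv'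
  have key : S.toSubalgebra.map φ.toAlgHom = ⊤ := by
    apply burnside_aux
    intro W hW
    have hinv : ∀ v, ∀ w ∈ W, φ (R v) w ∈ W := fun v w hw =>
      hW _ ⟨R v, StarAlgebra.subset_adjoin ℂ _ ⟨v, rfl⟩, rfl⟩ w hw
    have hdvd : d ∣ Module.finrank ℂ W := by
      refine trace_aux hd hcop (fun v => (φ (R v)).restrict (hinv v)) (fun v => ?_) ?_
      · ext1 w
        apply Subtype.ext
        have := congrArg (fun M => φ M (w : Fin d → ℂ)) (hproj v).2
        simpa using this
      · ext1 w
        apply Subtype.ext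
        have := congrArg (fun M => φ M (w : Fin d → ℂ)) hsum
        simp only [map_sum, map_smul, map_one, hbd] at this
        simpa [LinearMap.sum_apply] using this
    have hle := Submodule.finrank_le W
    rw [Module.finrank_fin_fun] at hle
    rcases Nat.eq_zero_or_pos (Module.finrank ℂ W) with h0 | h0
    · left; exact Submodule.finrank_eq_zero.mp h0
    · right
      apply Submodule.eq_top_of_finrank_eq
      rw [Module.finrank_fin_fun]
      exact le_antisymm hle (Nat.le_of_dvd h0 hdvd)
  rw [eq_top_iff]
  intro M _
  have : φ M ∈ S.toSubalgebra.map φ.toAlgHom := by rw [key]; trivial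
  obtain ⟨N, hN, hNM⟩ := this
  have : N = M := φ.injective hNM
  rw [← this]; exact hN

end QST
end
end

section
/- Let n ≥ 3 and let x ∈ Λ_n with x = b/d in lowest terms. If R_1, …, R_n ∈ M_d(ℂ) are projections such that R_1 + ⋯ + R_n = x·I_d, then the normalized trace satisfies (1/d)·tr(R_v R_w) = x/n when v = w, and (1/d)·tr(R_v R_w) = x(x−1)/(n(n−1)) when v ≠ w. More generally, if R_1, …, R_n ∈ M_k(ℂ) are projections for some k ∈ ℕ with R_1 + ⋯ + R_n = x·I_k, then tr(R_v) takes the same value for all v ∈ [n], and tr(R_v R_w) takes the same value for all pairs v ≠ w. -/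
open scoped Matrix Kronecker ComplexOrder

noncomputable section
namespace QST

/-- A family of idempotents in the corner `E A E` whose sum is `x • E`. -/
structure Fam {B : Type} [Ring B] [Algebra ℂ B] {n : ℕ} (x : ℂ) (E : B) (S : Fin n → B) : Prop where
  hE : E * E = E
  hS : ∀ v, S v * S v = S v
  hl : ∀ v, E * S v = S v
  hr : ∀ v, S v * E = S v
  hsum : ∑ v, S v = x • E

/-- All families at parameter `x` have constant traces. -/
def Good (n : ℕ) (x : ℂ) : Prop :=
  ∀ (ι : Type) [Fintype ι] [DecidableEq ι] (E : Matrix ι ι ℂ) (S : Fin n → Matrix ι ι ℂ),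
    Fam x E S →
      (∀ v w : Fin n, (S v).trace = (S w).trace) ∧
      (∀ v w v' w' : Fin n, v ≠ w → v' ≠ w' → (S v * S w).trace = (S v' * S w').trace)

theorem trace_idem {ι : Type} [Fintype ι] [DecidableEq ι] (S : Matrix ι ι ℂ) (h : S * S = S) :
    ∃ k : ℕ, S.trace = k := by
  have hi : IsIdempotentElem (Matrix.toLin' S) := by
    unfold IsIdempotentElem
    rw [Module.End.mul_eq_comp, ← Matrix.toLin'_mul, h]
  have := LinearMap.IsProj.trace (LinearMap.IsIdempotentElem.isProj_range _ hi)
  rw [Matrix.trace_toLin'_eq] at this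
  exact ⟨_, this⟩

theorem idem_zero {ι : Type} [Fintype ι] [DecidableEq ι] (S : Matrix ι ι ℂ) (h : S * S = S)
    (h0 : S.trace = 0) : S = 0 := by
  have hi : IsIdempotentElem (Matrix.toLin' S) := by
    unfold IsIdempotentElem
    rw [Module.End.mul_eq_comp, ← Matrix.toLin'_mul, h]
  have := LinearMap.IsIdempotentElem.eq_zero_of_trace_eq_zero hi
    (by rw [Matrix.trace_toLin'_eq, h0])
  simpa using this

theorem good_zero (n : ℕ) : Good n 0 := by
  intro ι _ _ E S h
  have hz : ∀ v, S v = 0 := by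
    choose k hk using fun v => trace_idem (S v) (h.hS v)
    have h1 : ∑ v, (S v).trace = 0 := by
      rw [← Matrix.trace_sum, h.hsum]; simp
    simp only [hk] at h1
    have h2 : ∑ v, k v = 0 := by exact_mod_cast h1
    intro v
    have h3 : k v = 0 := by
      have := (Finset.sum_eq_zero_iff.mp h2) v (Finset.mem_univ v)
      exact this
    exact idem_zero _ (h.hS v) (by rw [hk, h3]; simp)
  simp [hz]

theorem Fam.compl {B : Type} [Ring B] [Algebra ℂ B] {n : ℕ} {x : ℂ} {E : B} {S : Fin n → B}
    (h : Fam x E S) : Fam ((n : ℂ) - x) E (fun v => E - S v) where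
  hE := h.hE
  hS v := by simp [mul_sub, sub_mul, h.hE, h.hS, h.hl, h.hr]
  hl v := by simp [mul_sub, h.hE, h.hl]
  hr v := by simp [sub_mul, h.hE, h.hr]
  hsum := by
    rw [Finset.sum_sub_distrib, h.hsum, sub_smul]
    simp [← Nat.cast_smul_eq_nsmul ℂ]

theorem Good.compl {n : ℕ} {x : ℂ} (h : Good n x) : Good n ((n : ℂ) - x) := by
  intro ι _ _ E S hF
  have hc := hF.compl
  rw [sub_sub_cancel] at hc
  obtain ⟨h1, h2⟩ := h ι E _ hc
  have h1' : ∀ v w : Fin n, (S v).trace = (S w).trace := by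
    intro v w
    have := h1 v w
    simpa [Matrix.trace_sub] using this
  refine ⟨h1', fun v w v' w' hvw hvw' => ?_⟩
  have := h2 v w v' w' hvw hvw'
  simp only [mul_sub, sub_mul, hF.hE, hF.hl, hF.hr, Matrix.trace_sub] at this
  rw [h1' v v', h1' w v', h1' w' v'] at this
  linear_combination this

theorem fam_dual {B : Type} [Ring B] [Algebra ℂ B] {n : ℕ} {y : ℂ} (hy : y ≠ 0) (hy1 : y - 1 ≠ 0)
    {D Q : B} {P : Fin n → B}
    (hDD : D * D = D) (hDQ : D * Q = Q) (hQD : Q * D = Q) (hQQ : Q * Q = Q)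
    (hDP : ∀ v, D * P v = P v) (hPD : ∀ v, P v * D = P v) (hP : ∑ v, P v = D)
    (hPP : ∀ v, P v * P v = P v) (hPQP : ∀ v, P v * (Q * P v) = y⁻¹ • P v) :
    Fam (y / (y - 1)) (D - Q) (fun v => (y / (y - 1)) • ((D - Q) * P v * (D - Q))) := by
  have hE : (D - Q) * (D - Q) = D - Q := by
    simp [mul_sub, sub_mul, hDD, hDQ, hQD, hQQ]
  have hPEP : ∀ v, P v * ((D - Q) * P v) = (1 - y⁻¹) • P v := by
    intro v
    simp [mul_sub, sub_mul, hDP, hPP, hPQP, sub_smul]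
  refine ⟨hE, fun v => ?_, fun v => ?_, fun v => ?_, ?_⟩
  · have : (D - Q) * P v * (D - Q) * ((D - Q) * P v * (D - Q))
        = (1 - y⁻¹) • ((D - Q) * P v * (D - Q)) := by
      calc _ = (D - Q) * P v * ((D - Q) * (D - Q)) * P v * (D - Q) := by noncomm_ring
        _ = (D - Q) * (P v * ((D - Q) * P v)) * (D - Q) := by rw [hE]; simp only [mul_assoc]
        _ = _ := by rw [hPEP]; simp
    rw [smul_mul_smul_comm, this, smul_smul]
    congr 1
    field_simp
  · rw [mul_smul_comm, ← mul_assoc, ← mul_assoc, hE]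
  · rw [smul_mul_assoc, mul_assoc, hE]
  · rw [← Finset.smul_sum, ← Finset.sum_mul, ← Finset.mul_sum, hP]
    congr 1
    rw [sub_mul, hDD, hQD, hE]

theorem trace_comp' {ι κ : Type} [Fintype ι] [Fintype κ]
    (M : Matrix κ κ (Matrix ι ι ℂ)) :
    (Matrix.comp κ κ ι ι ℂ M).trace = M.trace.trace := by
  simp [Matrix.trace, Fintype.sum_prod_type, Matrix.sum_apply]
  exact Finset.sum_comm

theorem tr_comm {ι κ : Type} [Fintype ι] [Fintype κ] [DecidableEq ι] [DecidableEq κ]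
    (M N : Matrix κ κ (Matrix ι ι ℂ)) :
    (M * N).trace.trace = (N * M).trace.trace := by
  rw [← trace_comp', ← trace_comp']
  change (Matrix.compRingEquiv κ ι ℂ (M * N)).trace = (Matrix.compRingEquiv κ ι ℂ (N * M)).trace
  rw [map_mul, map_mul, Matrix.trace_mul_comm]

theorem Fam.map {B C : Type} [Ring B] [Algebra ℂ B] [Ring C] [Algebra ℂ C] {n : ℕ} {x : ℂ}
    {E : B} {S : Fin n → B} (h : Fam x E S) (f : B ≃ₐ[ℂ] C) : Fam x (f E) (fun v => f (S v)) where
  hE := by rw [← map_mul, h.hE]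
  hS v := by rw [← map_mul, h.hS]
  hl v := by rw [← map_mul, h.hl]
  hr v := by rw [← map_mul, h.hr]
  hsum := by rw [← map_sum, h.hsum, map_smul]

theorem Good.block {n : ℕ} {x : ℂ} (h : Good n x) {ι κ : Type} [Fintype ι] [Fintype κ]
    [DecidableEq ι] [DecidableEq κ] {E : Matrix κ κ (Matrix ι ι ℂ)}
    {S : Fin n → Matrix κ κ (Matrix ι ι ℂ)} (hF : Fam x E S) :
      (∀ v w : Fin n, (S v).trace.trace = (S w).trace.trace) ∧
      (∀ v w v' w' : Fin n, v ≠ w → v' ≠ w' →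
        (S v * S w).trace.trace = (S v' * S w').trace.trace) := by
  obtain ⟨h1, h2⟩ := h _ _ _ (hF.map (Matrix.compAlgEquiv κ ι ℂ ℂ))
  simp only [← map_mul] at h2
  simp only [Matrix.compAlgEquiv_apply, trace_comp'] at h1 h2
  exact ⟨h1, h2⟩

theorem Good.dual {n : ℕ} {y : ℂ} (hy : y ≠ 0) (hy1 : y - 1 ≠ 0)
    (h : Good n (y / (y - 1))) : Good n y := by
  intro ι _ _ E S hF
  let D : Matrix (Fin n) (Fin n) (Matrix ι ι ℂ) := Matrix.diagonal S
  let Q : Matrix (Fin n) (Fin n) (Matrix ι ι ℂ) := Matrix.of fun v w => y⁻¹ • (S v * S w)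
  let P : Fin n → Matrix (Fin n) (Fin n) (Matrix ι ι ℂ) := fun v => Matrix.single v v (S v)
  have hDD : D * D = D := by simp [D, hF.hS]
  have hDQ : D * Q = Q := by
    ext1 v w
    simp [D, Q, Matrix.diagonal_mul, ← mul_assoc, hF.hS]
  have hQD : Q * D = Q := by
    ext1 v w
    simp [D, Q, Matrix.mul_diagonal, mul_assoc, hF.hS]
  have hQQ : Q * Q = Q := by
    ext1 v w
    simp only [Q, Matrix.mul_apply, Matrix.of_apply]
    have : ∀ j, (y⁻¹ • (S v * S j)) * (y⁻¹ • (S j * S w)) = (y⁻¹ * y⁻¹) • (S v * S j * S w) := by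
      intro j
      rw [smul_mul_smul_comm, mul_assoc, ← mul_assoc (S j), hF.hS, mul_assoc]
    simp only [this]
    rw [← Finset.smul_sum, ← Finset.sum_mul, ← Finset.mul_sum, hF.hsum, mul_smul_comm, hF.hr,
      smul_mul_assoc, smul_smul]
    congr 1
    field_simp
  have hDP : ∀ v, D * P v = P v := by
    intro v
    simp only [D, P, ← Matrix.sum_single_eq_diagonal, Finset.sum_mul]
    rw [Finset.sum_eq_single v]
    · simp [hF.hS]
    · intro j _ hj
      exact Matrix.single_mul_single_of_ne _ _ _ _ hj _
    · simp
  have hPD : ∀ v, P v * D = P v := by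
    intro v
    simp only [D, P, ← Matrix.sum_single_eq_diagonal, Finset.mul_sum]
    rw [Finset.sum_eq_single v]
    · simp [hF.hS]
    · intro j _ hj
      exact Matrix.single_mul_single_of_ne _ _ _ _ hj.symm _
    · simp
  have hP : ∑ v, P v = D := Matrix.sum_single_eq_diagonal S
  have hPP : ∀ v, P v * P v = P v := by
    intro v; simp [P, hF.hS]
  have hPQP2 : ∀ v w, P v * Q * P w = Matrix.single v w (y⁻¹ • (S v * S w)) := by
    intro v w
    simp only [P, Q, Matrix.single_mul_mul_single, Matrix.of_apply]
    congr 1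
    rw [mul_smul_comm, smul_mul_assoc, ← mul_assoc, hF.hS, mul_assoc, hF.hS]
  have hPQP : ∀ v, P v * (Q * P v) = y⁻¹ • P v := by
    intro v
    rw [← mul_assoc, hPQP2, hF.hS]
    simp [P, Matrix.smul_single]
  have hG := fam_dual hy hy1 hDD hDQ hQD hQQ hDP hPD hP hPP hPQP
  obtain ⟨h1, h2⟩ := h.block hG
  have hE := hG.hE
  have hPEP : ∀ v, P v * ((D - Q) * P v) = (1 - y⁻¹) • P v := by
    intro v
    simp [mul_sub, sub_mul, hDP, hPP, hPQP, sub_smul]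
  have htr1 : ∀ v, ((y / (y - 1)) • ((D - Q) * P v * (D - Q))).trace.trace = (S v).trace := by
    intro v
    have e : ((D - Q) * P v * (D - Q)).trace.trace = (1 - y⁻¹) * (S v).trace := by
      rw [tr_comm, ← mul_assoc, hE, ← hPP v, ← mul_assoc, tr_comm, hPEP]
      simp [P, Matrix.trace_smul]
    rw [Matrix.trace_smul, Matrix.trace_smul, e, smul_eq_mul]
    field_simp
  have htr2 : ∀ v w, v ≠ w → ((y / (y - 1)) • ((D - Q) * P v * (D - Q)) *
      ((y / (y - 1)) • ((D - Q) * P w * (D - Q)))).trace.trace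
      = (1 / (y - 1)) ^ 2 * (S v * S w).trace := by
    intro v w hvw
    have hPPz : P v * P w = 0 := Matrix.single_mul_single_of_ne _ _ _ _ hvw _
    have e1 : P v * (D - Q) * P w = - Matrix.single v w (y⁻¹ • (S v * S w)) := by
      rw [mul_sub, sub_mul, hPD, hPPz, hPQP2, zero_sub]
    have e : ((D - Q) * P v * (D - Q) * ((D - Q) * P w * (D - Q))).trace.trace
        = y⁻¹ ^ 2 * (S v * S w).trace := by
      have : (D - Q) * P v * (D - Q) * ((D - Q) * P w * (D - Q))
          = (D - Q) * (P v * ((D - Q) * (D - Q)) * P w) * (D - Q) := by noncomm_ring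
      rw [this, hE, e1, tr_comm, ← mul_assoc, hE, mul_neg, Matrix.trace_neg, Matrix.trace_mul_single]
      have hDwv : (D - Q) w v = - (y⁻¹ • (S w * S v)) := by
        simp [D, Q, Matrix.diagonal_apply_ne _ hvw.symm]
      rw [hDwv, op_smul_eq_mul]
      have : S w * S v * (S v * S w) = S w * (S v * S w) := by
        rw [mul_assoc, ← mul_assoc (S v), hF.hS]
      simp only [neg_mul, neg_neg, smul_mul_smul_comm, this, Matrix.trace_smul, smul_eq_mul]
      rw [Matrix.trace_mul_comm, mul_assoc (S v), hF.hS]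
      ring
    rw [smul_mul_smul_comm, Matrix.trace_smul, Matrix.trace_smul, e, smul_eq_mul]
    field_simp
  simp only [htr1] at h1
  refine ⟨h1, fun v w v' w' hvw hvw' => ?_⟩
  have := h2 v w v' w' hvw hvw'
  rw [htr2 _ _ hvw, htr2 _ _ hvw'] at this
  exact mul_left_cancel₀ (pow_ne_zero 2 (one_div_ne_zero hy1)) this

theorem Good.step {n : ℕ} {x : ℝ} (hx : x < (n : ℝ) - 1) (h : Good n (x : ℂ)) :
    Good n ((1 + 1 / ((n : ℝ) - 1 - x) : ℝ) : ℂ) := by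
  have hpos : 0 < (n : ℝ) - 1 - x := by linarith
  set t := (n : ℝ) - 1 - x with ht
  have h1 : 0 < 1 / t := by positivity
  have hy : ((1 + 1 / t : ℝ) : ℂ) ≠ 0 := by
    exact_mod_cast (by positivity : (1 + 1 / t) ≠ 0)
  have hy1' : ((1 + 1 / t : ℝ) : ℂ) - 1 = ((1 / t : ℝ) : ℂ) := by push_cast; ring
  have hy1 : ((1 + 1 / t : ℝ) : ℂ) - 1 ≠ 0 := by
    rw [hy1']; exact_mod_cast h1.ne'
  apply Good.dual hy hy1
  have : ((1 + 1 / t : ℝ) : ℂ) / (((1 + 1 / t : ℝ) : ℂ) - 1) = (n : ℂ) - x := by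
    rw [hy1', ← Complex.ofReal_div]
    have : (1 + 1 / t) / (1 / t) = (n : ℝ) - x := by
      field_simp
      rw [ht]; ring
    rw [this]; push_cast; rfl
  rw [this]
  exact h.compl

theorem good_seq {n : ℕ} (hn : 4 ≤ n) (l : ℕ) :
    lambdaSeq n l ≤ 2 ∧ Good n (lambdaSeq n l : ℂ) := by
  have hn' : (4 : ℝ) ≤ n := by exact_mod_cast hn
  induction l with
  | zero => simpa [lambdaSeq] using good_zero n
  | succ l ih =>
    obtain ⟨h1, h2⟩ := ih
    refine ⟨?_, h2.step (by linarith)⟩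
    have : 1 / ((n : ℝ) - 1 - lambdaSeq n l) ≤ 1 := by
      rw [div_le_one (by linarith)]; linarith
    simp only [lambdaSeq]
    linarith

theorem good_Lambda {n : ℕ} (hn : 3 ≤ n) {x : ℝ} (hx : x ∈ Lambda n) : Good n (x : ℂ) := by
  unfold Lambda at hx
  split_ifs at hx with h3
  · subst h3
    rw [Set.mem_singleton_iff] at hx
    have := Good.step (n := 3) (x := 0) (by norm_num) (by simpa using good_zero 3)
    convert this using 2
    rw [hx]; norm_num
  · obtain ⟨l, rfl⟩ := hx
    exact (good_seq (by omega) l).2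

theorem statement8 {n b d : ℕ} (hn : 3 ≤ n) (x : ℝ) (hx : x ∈ Lambda n)
    (hd : 0 < d) (hcop : Nat.Coprime b d) (hbd : x = (b : ℝ) / d)
    (R : Fin n → Matrix (Fin d) (Fin d) ℂ)
    (hproj : ∀ v, IsProjection (R v)) (hsum : ∑ v, R v = (x : ℂ) • 1) :
    (∀ v w : Fin n, v = w →
      (1 / (d : ℂ)) * (R v * R w).trace = ((x / n : ℝ) : ℂ)) ∧
    (∀ v w : Fin n, v ≠ w →
      (1 / (d : ℂ)) * (R v * R w).trace = ((x * (x - 1) / (n * (n - 1)) : ℝ) : ℂ)) ∧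
    ∀ (m : ℕ) (S : Fin n → Matrix (Fin m) (Fin m) ℂ),
      (∀ v, IsProjection (S v)) → ∑ v, S v = (x : ℂ) • 1 →
      (∀ v w : Fin n, (S v).trace = (S w).trace) ∧
      (∀ v w v' w' : Fin n, v ≠ w → v' ≠ w' →
        (S v * S w).trace = (S v' * S w').trace) := by
  have hG := good_Lambda hn hx
  have key : ∀ (m : ℕ) (S : Fin n → Matrix (Fin m) (Fin m) ℂ),
      (∀ v, IsProjection (S v)) → ∑ v, S v = (x : ℂ) • 1 →
      (∀ v w : Fin n, (S v).trace = (S w).trace) ∧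
      (∀ v w v' w' : Fin n, v ≠ w → v' ≠ w' →
        (S v * S w).trace = (S v' * S w').trace) := by
    intro m S hS hs
    exact hG _ 1 S ⟨by simp, fun v => (hS v).2, by simp, by simp, hs⟩
  obtain ⟨h1, h2⟩ := key d R hproj hsum
  have hn0 : (n : ℂ) ≠ 0 := by
    have : n ≠ 0 := by omega
    exact_mod_cast this
  have hn1 : (n : ℂ) - 1 ≠ 0 := by
    have : n ≠ 1 := by omega
    rw [sub_ne_zero]
    exact_mod_cast this
  have hd0 : (d : ℂ) ≠ 0 := by exact_mod_cast hd.ne'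
  have htr : ∀ v, (n : ℂ) * (R v).trace = x * d := by
    intro v
    have := congrArg Matrix.trace hsum
    rw [Matrix.trace_sum, Finset.sum_congr rfl (fun w _ => h1 w v)] at this
    simpa using this
  refine ⟨?_, ?_, key⟩
  · rintro v _ rfl
    rw [(hproj v).2]
    push_cast
    field_simp
    linear_combination htr v
  · intro v w hvw
    have e : (R v).trace + ((n : ℂ) - 1) * (R v * R w).trace = x * (R v).trace := by
      have h := congrArg (fun M => (R v * M).trace) hsum
      simp only [Finset.mul_sum, Matrix.trace_sum] at h
      rw [← Finset.add_sum_erase _ _ (Finset.mem_univ v), (hproj v).2,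
        Finset.sum_congr rfl (fun u hu => h2 v u v w (Finset.ne_of_mem_erase hu).symm hvw)] at h
      simp only [Finset.sum_const, Finset.card_erase_of_mem (Finset.mem_univ v),
        Finset.card_univ, Fintype.card_fin, nsmul_eq_mul] at h
      rw [Nat.cast_sub (by omega)] at h
      simpa using h
    push_cast
    field_simp
    linear_combination (n : ℂ) * e + ((x : ℂ) - 1) * htr v

end QST
end
end

section
/- Let n ≥ 3. If R_1, …, R_n ∈ M_{n−1}(ℂ) are projections with R_1 + ⋯ + R_n = (n/(n−1))·I_{n−1}, then there exist unit vectors ξ_1, …, ξ_n ∈ ℂ^{n−1} with R_v = ξ_v ξ_v* for all v and |⟨ξ_v, ξ_w⟩| = 1/(n−1) for all v ≠ w. Conversely, if ξ_1, …, ξ_n ∈ ℂ^{n−1} are unit vectors with |⟨ξ_v, ξ_w⟩| = 1/(n−1) for all v ≠ w, then the rank-one projections R_v = ξ_v ξ_v* satisfy R_1 + ⋯ + R_n = (n/(n−1))·I_{n−1}. -/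
open scoped Matrix Kronecker ComplexOrder

noncomputable section
namespace QST

theorem aux_rank_one {ι : Type} [Fintype ι] [DecidableEq ι] (Q : Matrix ι ι ℂ)
    (h1 : Qᴴ = Q) (h2 : Q * Q = Q) (h3 : Q.trace = 1) :
    ∃ η : ι → ℂ, ∀ i j, Q i j = η i * star (η j) := by
  have hst : ∀ i j, star (Q i j) = Q j i := fun i j => by
    conv_rhs => rw [← h1]
    rfl
  obtain ⟨k, hk⟩ : ∃ k, Q k k ≠ 0 := by
    by_contra! h
    have : Q.trace = 0 := by simp [Matrix.trace, h]
    rw [h3] at this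
    exact one_ne_zero this
  have hmul : ∀ i j, ∑ l, Q i l * Q l j = Q i j := fun i j => by
    rw [← Matrix.mul_apply, h2]
  obtain ⟨r, hr0, hr⟩ : ∃ r : ℝ, 0 < r ∧ Q k k = (r : ℂ) := by
    have : Q k k = ((∑ l, ‖Q k l‖ ^ 2 : ℝ) : ℂ) := by
      rw [← hmul k k]
      push_cast
      refine Finset.sum_congr rfl fun l _ => ?_
      rw [← hst k l]
      exact Complex.mul_conj' _
    refine ⟨_, ?_, this⟩
    have h0 : (0:ℝ) ≤ ∑ l, ‖Q k l‖ ^ 2 := Finset.sum_nonneg fun _ _ => by positivity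
    refine lt_of_le_of_ne h0 fun h => hk ?_
    rw [this, ← h]; simp
  have hrc : (r : ℂ) ≠ 0 := by exact_mod_cast hr0.ne'
  let P : Matrix ι ι ℂ := Matrix.of fun i j => (r : ℂ)⁻¹ * (Q i k * Q k j)
  have hPH : Pᴴ = P := by
    ext i j
    simp only [P, Matrix.conjTranspose_apply, Matrix.of_apply, star_mul', hst, star_inv₀]
    simp; left; ring
  have hQP : Q * P = P := by
    ext i j
    simp only [P, Matrix.mul_apply, Matrix.of_apply]
    rw [← hmul i k, Finset.sum_mul, Finset.mul_sum]
    exact Finset.sum_congr rfl fun _ _ => by ring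
  have hPQ : P * Q = P := by
    have := congrArg Matrix.conjTranspose hQP
    rwa [Matrix.conjTranspose_mul, h1, hPH] at this
  have hPP : P * P = P := by
    ext i j
    simp only [P, Matrix.mul_apply, Matrix.of_apply]
    calc _ = ∑ l, (Q k l * Q l k) * ((r:ℂ)⁻¹ * (r:ℂ)⁻¹ * (Q i k * Q k j)) :=
          Finset.sum_congr rfl fun _ _ => by ring
      _ = _ := by rw [← Finset.sum_mul, hmul, hr]; field_simp
  have hPt : P.trace = 1 := by
    simp only [P, Matrix.trace, Matrix.diag_apply, Matrix.of_apply]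
    rw [← Finset.mul_sum]
    calc _ = (r:ℂ)⁻¹ * ∑ l, (Q k l * Q l k) := by
          congr 1
          exact Finset.sum_congr rfl fun _ _ => by ring
      _ = _ := by rw [hmul, hr]; field_simp
  have hz : Q - P = 0 := by
    rw [← Matrix.trace_conjTranspose_mul_self_eq_zero_iff, Matrix.conjTranspose_sub, h1, hPH,
      sub_mul, mul_sub, mul_sub, h2, hQP, hPQ, hPP]
    simp [h3, hPt]
  have hs : ((Real.sqrt r : ℝ) : ℂ) * (Real.sqrt r : ℝ) = r := by
    rw [← Complex.ofReal_mul, Real.mul_self_sqrt hr0.le]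
  refine ⟨fun i => ((Real.sqrt r : ℝ) : ℂ)⁻¹ * Q i k, fun i j => ?_⟩
  refine (congrFun (congrFun (sub_eq_zero.1 hz) i) j).trans ?_
  simp only [P, Matrix.of_apply, star_mul', hst, star_inv₀]
  rw [← hs, mul_inv]
  simp; ring

theorem aux_evnorm {ι : Type} [Fintype ι] (x : ι → ℂ) :
    pinner x x = ((evnorm x ^ 2 : ℝ) : ℂ) := by
  unfold pinner evnorm
  rw [Real.sq_sqrt (Finset.sum_nonneg fun _ _ => by positivity)]
  push_cast
  exact Finset.sum_congr rfl fun l _ => Complex.mul_conj' _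

theorem aux_fwd {n m : ℕ} (hm : 1 ≤ m) (hnm : n = m + 1)
    (R : Fin n → Matrix (Fin m) (Fin m) ℂ) (hR : ∀ v, IsProjection (R v))
    (hS : ∑ v, R v = (((n : ℝ) / ((n : ℝ) - 1) : ℝ) : ℂ) • 1) :
    ∃ ξ : Fin n → Fin m → ℂ,
        (∀ v, evnorm (ξ v) = 1) ∧
        (∀ v, R v = Matrix.of fun a b => ξ v a * (starRingEnd ℂ) (ξ v b)) ∧
        ∀ v w, v ≠ w → ‖pinner (ξ v) (ξ w)‖ = 1 / ((n : ℝ) - 1) := by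
  have hmR : (0:ℝ) < m := by exact_mod_cast hm
  have hnR : (n : ℝ) = m + 1 := by rw [hnm]; push_cast; ring
  have hn0 : (0:ℝ) < n := by linarith
  set c : ℝ := (n : ℝ) / ((n : ℝ) - 1) with hc
  have hn1 : (n : ℝ) - 1 = m := by linarith
  have hc0 : 0 < c := by rw [hc, hn1]; positivity
  have hcC : (c : ℂ) ≠ 0 := by exact_mod_cast hc0.ne'
  have hcm : c * m = n := by rw [hc, hn1]; field_simp
  have hcmC : (c:ℂ) * m = n := by exact_mod_cast hcm
  have hst : ∀ v i j, star (R v i j) = R v j i := fun v i j => by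
    conv_rhs => rw [← (hR v).1]
    rfl
  have hmul : ∀ v i j, ∑ l, R v i l * R v l j = R v i j := fun v i j => by
    rw [← Matrix.mul_apply, (hR v).2]
  let V : Matrix (Fin m) (Fin m × Fin n) ℂ := Matrix.of fun a p => R p.2 a p.1
  let D : Matrix (Fin m × Fin n) (Fin m × Fin n) ℂ := Matrix.blockDiagonal R
  have hVV : V * Vᴴ = (c:ℂ) • 1 := by
    rw [← hS]
    ext i j
    simp only [V, Matrix.mul_apply, Matrix.of_apply, Matrix.conjTranspose_apply, hst,
      Fintype.sum_prod_type_right, hmul, Matrix.sum_apply]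
  have hVD : V * D = V := by
    ext i ⟨j, v⟩
    simp only [V, D, Matrix.mul_apply, Matrix.of_apply, Fintype.sum_prod_type_right,
      Matrix.blockDiagonal_apply, mul_ite, mul_zero]
    rw [Finset.sum_eq_single v]
    · simp [hmul]
    · intro w _ hw; simp [hw]
    · simp
  have hDH : Dᴴ = D := by
    simp only [D, Matrix.blockDiagonal_conjTranspose]
    congr 1; funext v; exact (hR v).1
  have hDD : D * D = D := by
    simp only [D, ← Matrix.blockDiagonal_mul]
    congr 1; funext v; exact (hR v).2
  have hDV : D * Vᴴ = Vᴴ := by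
    have := congrArg Matrix.conjTranspose hVD
    rwa [Matrix.conjTranspose_mul, hDH] at this
  have htr : ∑ v, (R v).trace = n := by
    rw [← Matrix.trace_sum, hS, Matrix.trace_smul, Matrix.trace_one]
    simpa using hcmC
  have hDt : D.trace = n := by
    simp only [D, Matrix.trace_blockDiagonal, htr]
  let G := Vᴴ * V
  have hGG : G * G = (c:ℂ) • G := by
    calc G * G = Vᴴ * (V * Vᴴ) * V := by simp only [G, Matrix.mul_assoc]
      _ = _ := by rw [hVV]; simp [G]
  have hGH : Gᴴ = G := by simp [G]
  have hGD : G * D = G := by simp only [G, Matrix.mul_assoc, hVD]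
  have hDG : D * G = G := by simp only [G, ← Matrix.mul_assoc, hDV]
  have hGt : G.trace = n := by
    simp only [G]
    rw [Matrix.trace_mul_comm, hVV, Matrix.trace_smul, Matrix.trace_one]
    simpa using hcmC
  have hncC : (n:ℂ) = m + 1 := by exact_mod_cast hnR
  obtain ⟨η, hη⟩ := aux_rank_one (D - (c:ℂ)⁻¹ • G)
    (by rw [Matrix.conjTranspose_sub, Matrix.conjTranspose_smul, hGH, hDH]; simp)
    (by
      rw [sub_mul, mul_sub, mul_sub, hDD, Matrix.smul_mul, Matrix.smul_mul, Matrix.mul_smul,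
        Matrix.mul_smul, hGG, hGD, hDG, smul_smul (c:ℂ)⁻¹ (c:ℂ), inv_mul_cancel₀ hcC]
      simp)
    (by
      rw [Matrix.trace_sub, Matrix.trace_smul, hDt, hGt, smul_eq_mul]
      have : (c:ℂ)⁻¹ * n = m := by rw [← hcmC]; field_simp
      rw [this, hncC]; ring)
  have hGapp : ∀ v w a b, G (a, v) (b, w) = (R v * R w) a b := by
    intro v w a b
    simp only [G, V, Matrix.mul_apply, Matrix.of_apply, Matrix.conjTranspose_apply, hst]
  have hsn : ((Real.sqrt n : ℝ) : ℂ) * (Real.sqrt n : ℝ) = n := by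
    rw [← Complex.ofReal_mul, Real.mul_self_sqrt hn0.le]; simp
  have hnC0 : (n:ℂ) ≠ 0 := by exact_mod_cast hn0.ne'
  have hcinv : (c:ℂ)⁻¹ = 1 - (n:ℂ)⁻¹ := by
    field_simp
    linear_combination -hcmC - (c:ℂ) * hncC
  let ξ : Fin n → Fin m → ℂ := fun v a => ((Real.sqrt n : ℝ) : ℂ) * η (a, v)
  have hξ : ∀ v w a b, ξ v a * star (ξ w b) = n * (η (a, v) * star (η (b, w))) := by
    intro v w a b
    simp only [ξ, star_mul']
    rw [← hsn]; simp; ring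
  have hRξ : ∀ v a b, R v a b = ξ v a * star (ξ v b) := by
    intro v a b
    rw [hξ, ← hη, Matrix.sub_apply, Matrix.smul_apply, hGapp, (hR v).2, hcinv]
    simp only [D, Matrix.blockDiagonal_apply, smul_eq_mul, if_true]
    field_simp; ring
  have hoff : ∀ v w a b, v ≠ w → (R v * R w) a b * (c:ℂ)⁻¹ * n = - (ξ v a * star (ξ w b)) := by
    intro v w a b hvw
    rw [hξ, ← hη, Matrix.sub_apply, Matrix.smul_apply, hGapp]
    simp only [D, Matrix.blockDiagonal_apply, smul_eq_mul, if_neg hvw]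
    ring
  have hRR : ∀ v w a b, (R v * R w) a b = ξ v a * star (ξ w b) * pinner (ξ w) (ξ v) := by
    intro v w a b
    simp only [Matrix.mul_apply, hRξ, pinner, Finset.mul_sum]
    exact Finset.sum_congr rfl fun l _ => by rw [starRingEnd_apply]; ring
  have htrξ : ∀ v, (R v).trace = pinner (ξ v) (ξ v) := by
    intro v
    simp only [Matrix.trace, Matrix.diag_apply, hRξ, pinner, starRingEnd_apply]
  have h01 : ∀ v, evnorm (ξ v) ^ 2 ≤ 1 := by
    intro v
    have h : pinner (ξ v) (ξ v) * pinner (ξ v) (ξ v) = pinner (ξ v) (ξ v) := by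
      have h1 := htrξ v
      rw [← (hR v).2] at h1
      simp only [Matrix.trace, Matrix.diag_apply, hRR] at h1
      rw [← Finset.sum_mul] at h1
      exact h1
    rw [aux_evnorm] at h
    have h' : evnorm (ξ v) ^ 2 * evnorm (ξ v) ^ 2 = evnorm (ξ v) ^ 2 := by exact_mod_cast h
    nlinarith
  have hsum : ∑ v, evnorm (ξ v) ^ 2 = n := by
    have := htr
    simp only [htrξ, aux_evnorm] at this
    exact_mod_cast this
  have hsq : ∀ v, evnorm (ξ v) ^ 2 = 1 := by
    have := (Finset.sum_eq_sum_iff_of_le (s := Finset.univ) (f := fun v => evnorm (ξ v) ^ 2)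
      (g := fun _ => (1:ℝ)) (fun v _ => h01 v)).1 (by rw [hsum]; simp)
    exact fun v => this v (Finset.mem_univ v)
  have hone : ∀ v, evnorm (ξ v) = 1 := fun v => by
    have h0 : 0 ≤ evnorm (ξ v) := Real.sqrt_nonneg _
    nlinarith [hsq v]
  have hne : ∀ v, ∃ a, ξ v a ≠ 0 := by
    intro v
    by_contra! h
    have := hone v
    simp [evnorm, h] at this
  refine ⟨ξ, hone, fun v => by ext a b; exact hRξ v a b, fun v w hvw => ?_⟩
  obtain ⟨a, ha⟩ := hne w
  obtain ⟨b, hb⟩ := hne v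
  have h := hoff w v a b hvw.symm
  rw [hRR] at h
  have hz : ξ w a * star (ξ v b) ≠ 0 := mul_ne_zero ha (star_ne_zero.2 hb)
  have h2 : pinner (ξ v) (ξ w) = -((c / n : ℝ) : ℂ) := by
    have h3 : pinner (ξ v) (ξ w) * (c:ℂ)⁻¹ * n = -1 := by
      apply mul_left_cancel₀ hz
      linear_combination h
    push_cast
    field_simp at h3 ⊢
    exact h3
  rw [h2, norm_neg, Complex.norm_real, Real.norm_of_nonneg (by positivity), hc]
  field_simp

theorem aux_bwd {n m : ℕ} (hm : 1 ≤ m) (hnm : n = m + 1)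
    (ξ : Fin n → Fin m → ℂ)
    (h1 : ∀ v, evnorm (ξ v) = 1)
    (h2 : ∀ v w, v ≠ w → ‖pinner (ξ v) (ξ w)‖ = 1 / ((n : ℝ) - 1)) :
      ∑ v, (Matrix.of fun a b => ξ v a * (starRingEnd ℂ) (ξ v b))
        = ((((n : ℝ) / ((n : ℝ) - 1) : ℝ) : ℂ) • 1 : Matrix (Fin m) (Fin m) ℂ) := by
  have hmR : (0:ℝ) < m := by exact_mod_cast hm
  have hnR : (n : ℝ) = m + 1 := by rw [hnm]; push_cast; ring
  have hn1 : (n : ℝ) - 1 = m := by linarith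
  rw [hn1]
  simp only [hn1] at h2
  have hmC : (m:ℂ) ≠ 0 := by exact_mod_cast hmR.ne'
  have hncC : (n:ℂ) = m + 1 := by exact_mod_cast hnR
  set c : ℝ := (n : ℝ) / m with hc
  let P : Fin n → Matrix (Fin m) (Fin m) ℂ :=
    fun v => Matrix.of fun a b => ξ v a * (starRingEnd ℂ) (ξ v b)
  change ∑ v, P v = _
  have hPH : ∀ v, (P v)ᴴ = P v := by
    intro v; ext a b
    simp [P, mul_comm]
  have hPt : ∀ v, (P v).trace = 1 := by
    intro v
    have := aux_evnorm (ξ v)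
    rw [h1] at this
    simpa [P, Matrix.trace, pinner] using this
  have hPP : ∀ v w, (P v * P w).trace = ((‖pinner (ξ v) (ξ w)‖ ^ 2 : ℝ) : ℂ) := by
    intro v w
    push_cast
    rw [← Complex.mul_conj']
    simp only [Matrix.trace, Matrix.diag_apply, Matrix.mul_apply, P, Matrix.of_apply, pinner,
      map_sum, map_mul, Complex.conj_conj, Finset.sum_mul_sum]
    exact Finset.sum_congr rfl fun _ _ => Finset.sum_congr rfl fun _ _ => by ring
  have hrow : ∀ v, ∑ w, (P v * P w).trace = (c : ℂ) := by
    intro v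
    rw [← Finset.add_sum_erase _ _ (Finset.mem_univ v)]
    have e1 : (P v * P v).trace = 1 := by
      rw [hPP, aux_evnorm, h1]; simp
    have e2 : ∑ w ∈ Finset.univ.erase v, (P v * P w).trace
        = ∑ w ∈ Finset.univ.erase v, (((1 / (m:ℝ)) ^ 2 : ℝ) : ℂ) := by
      refine Finset.sum_congr rfl fun w hw => ?_
      rw [hPP, h2 v w (Finset.ne_of_mem_erase hw).symm]
    rw [e1, e2, Finset.sum_const, Finset.card_erase_of_mem (Finset.mem_univ v)]
    simp only [Finset.card_univ, Fintype.card_fin, hnm, Nat.add_sub_cancel, nsmul_eq_mul, hc]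
    push_cast
    field_simp
  set S := ∑ v, P v with hS
  have hSt : S.trace = n := by
    rw [hS, Matrix.trace_sum]; simp [hPt]
  have hSS : (S * S).trace = n * c := by
    rw [hS, Finset.sum_mul_sum, Matrix.trace_sum]
    simp only [Matrix.trace_sum, hrow]
    simp
  have hSH : Sᴴ = S := by
    rw [hS, Matrix.conjTranspose_sum]; simp only [hPH]
  rw [← sub_eq_zero, ← Matrix.trace_conjTranspose_mul_self_eq_zero_iff, Matrix.conjTranspose_sub,
    Matrix.conjTranspose_smul, hSH, Matrix.conjTranspose_one, sub_mul, mul_sub, mul_sub]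
  simp only [Matrix.trace_sub, hSS, Matrix.smul_mul, Matrix.mul_smul, Matrix.trace_smul, mul_one,
    one_mul, hSt, Matrix.trace_one, Fintype.card_fin, smul_eq_mul]
  rw [hc]
  simp
  field_simp
  ring

theorem statement9 {n : ℕ} (hn : 3 ≤ n) :
    (∀ R : Fin n → Matrix (Fin (n - 1)) (Fin (n - 1)) ℂ,
      (∀ v, IsProjection (R v)) →
      ∑ v, R v = (((n : ℝ) / ((n : ℝ) - 1) : ℝ) : ℂ) • 1 →
      ∃ ξ : Fin n → Fin (n - 1) → ℂ,
        (∀ v, evnorm (ξ v) = 1) ∧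
        (∀ v, R v = Matrix.of fun a b => ξ v a * (starRingEnd ℂ) (ξ v b)) ∧
        ∀ v w, v ≠ w → ‖pinner (ξ v) (ξ w)‖ = 1 / ((n : ℝ) - 1)) ∧
    ∀ ξ : Fin n → Fin (n - 1) → ℂ,
      (∀ v, evnorm (ξ v) = 1) →
      (∀ v w, v ≠ w → ‖pinner (ξ v) (ξ w)‖ = 1 / ((n : ℝ) - 1)) →
      ∑ v, (Matrix.of fun a b => ξ v a * (starRingEnd ℂ) (ξ v b))
        = (((n : ℝ) / ((n : ℝ) - 1) : ℝ) : ℂ) • 1 := by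
  exact ⟨fun R hR hS => aux_fwd (by omega) (by omega) R hR hS,
    fun ξ h1 h2 => aux_bwd (by omega) (by omega) ξ h1 h2⟩

end QST
end
end

section
/- Let n ≥ 3 and let x ∈ Λ_n with x = b/d in lowest terms. Let R_1, …, R_n ∈ M_d(ℂ) be projections such that R_1 + ⋯ + R_n = x·I_d, and set N = Σ_{v=1}^n R_v ⊗ R_vᵀ ∈ M_d(ℂ) ⊗ M_d(ℂ). Then x is the largest eigenvalue of N, and the eigenspace of N corresponding to x is the one-dimensional subspace spanned by the maximally entangled state φ_d. -/
open scoped Matrix Kronecker ComplexOrder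

noncomputable section
namespace QST

/-- The matrix of a bipartite vector. -/
def matOf {d : ℕ} (ξ : Fin d × Fin d → ℂ) : Matrix (Fin d) (Fin d) ℂ :=
  Matrix.of fun i j => ξ (i, j)

theorem matOf_inj {d : ℕ} {ξ η : Fin d × Fin d → ℂ} (h : matOf ξ = matOf η) : ξ = η := by
  funext y
  exact congrFun (congrFun h y.1) y.2

theorem matOf_smul {d : ℕ} (c : ℂ) (ξ : Fin d × Fin d → ℂ) : matOf (c • ξ) = c • matOf ξ := by
  ext i j; simp [matOf]

theorem matOf_phid (d : ℕ) : matOf (phid d) = (((Real.sqrt d)⁻¹ : ℝ) : ℂ) • 1 := by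
  ext i j; simp [matOf, phid, Matrix.one_apply]

theorem matOf_mulVec {n d : ℕ} (R : Fin n → Matrix (Fin d) (Fin d) ℂ)
    (ξ : Fin d × Fin d → ℂ) :
    matOf ((∑ v, R v ⊗ₖ (R v)ᵀ).mulVec ξ) = ∑ v, R v * matOf ξ * R v := by
  rw [Matrix.sum_mulVec]
  ext i j
  simp only [matOf, Matrix.of_apply, Finset.sum_apply, Matrix.sum_apply]
  refine Finset.sum_congr rfl fun v _ => ?_
  simp only [Matrix.mulVec, dotProduct, Matrix.kroneckerMap_apply, Matrix.transpose_apply,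
    Matrix.mul_apply, Fintype.sum_prod_type, Finset.sum_mul, Matrix.of_apply]
  rw [Finset.sum_comm]
  refine Finset.sum_congr rfl fun k _ => Finset.sum_congr rfl fun l _ => ?_
  ring

theorem cx_nonneg {a t : ℂ} (h : 0 ≤ a * t) (ht : 0 < t) : 0 ≤ a := by
  rw [Complex.lt_def] at ht
  rw [Complex.le_def] at h ⊢
  simp only [Complex.zero_re, Complex.zero_im, Complex.mul_re, Complex.mul_im] at *
  obtain ⟨h1, h2⟩ := ht
  obtain ⟨h3, h4⟩ := h
  rw [← h2] at h3 h4
  simp only [mul_zero, sub_zero, zero_add] at h3 h4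
  refine ⟨nonneg_of_mul_nonneg_left h3 h1, ?_⟩
  rcases mul_eq_zero.mp h4.symm with h | h
  · exact h.symm
  · exact absurd h h1.ne'

theorem tr_idem {V : Type} [AddCommGroup V] [Module ℂ V] [FiniteDimensional ℂ V]
    (T : V →ₗ[ℂ] V) (hT : IsIdempotentElem T) : ∃ k : ℕ, LinearMap.trace ℂ V T = k :=
  ⟨_, LinearMap.IsProj.trace (LinearMap.IsIdempotentElem.isProj_range T hT)⟩

theorem tr_nonneg {d : ℕ} (A : Matrix (Fin d) (Fin d) ℂ) : 0 ≤ (Aᴴ * A).trace :=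
  (Matrix.posSemidef_conjTranspose_mul_self A).trace_nonneg

theorem key1 {d : ℕ} {R : Matrix (Fin d) (Fin d) ℂ} (h : IsProjection R)
    (X : Matrix (Fin d) (Fin d) ℂ) :
    ((R * X * R)ᴴ * (R * X * R)).trace = (Xᴴ * (R * X * R)).trace := by
  obtain ⟨h1, h2⟩ := h
  simp only [Matrix.conjTranspose_mul, h1]
  have : R * (Xᴴ * R) * (R * X * R) = R * (Xᴴ * (R * X * R)) := by
    have : R * (Xᴴ * R) * (R * X * R) = R * (Xᴴ * ((R * R) * X * R)) := by noncomm_ring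
    rw [this, h2]
  rw [this, Matrix.trace_mul_comm]
  congr 1
  simp only [Matrix.mul_assoc, h2]

theorem key2 {d : ℕ} {R : Matrix (Fin d) (Fin d) ℂ} (h : IsProjection R)
    (X : Matrix (Fin d) (Fin d) ℂ) :
    ((R * X - R * X * R)ᴴ * (R * X - R * X * R)).trace
      = (Xᴴ * (R * X)).trace - (Xᴴ * (R * X * R)).trace := by
  have h3 := key1 h X
  obtain ⟨h1, h2⟩ := h
  have e1 : ((R * X)ᴴ * (R * X)).trace = (Xᴴ * (R * X)).trace := by
    simp only [Matrix.conjTranspose_mul, h1]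
    rw [show Xᴴ * R * (R * X) = Xᴴ * ((R * R) * X) by noncomm_ring, h2]
  have e2 : ((R * X)ᴴ * (R * X * R)).trace = (Xᴴ * (R * X * R)).trace := by
    simp only [Matrix.conjTranspose_mul, h1]
    rw [show Xᴴ * R * (R * X * R) = Xᴴ * ((R * R) * X * R) by noncomm_ring, h2]
  have e3 : ((R * X * R)ᴴ * (R * X)).trace = (Xᴴ * (R * X * R)).trace := by
    simp only [Matrix.conjTranspose_mul, h1]
    rw [show R * (Xᴴ * R) * (R * X) = R * (Xᴴ * ((R * R) * X)) by noncomm_ring, h2,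
      Matrix.trace_mul_comm]
    simp only [Matrix.mul_assoc]
  rw [Matrix.conjTranspose_sub, Matrix.sub_mul, Matrix.mul_sub, Matrix.mul_sub]
  simp only [Matrix.trace_sub, e1, e2, e3, h3]
  ring

theorem sum_key2 {n d : ℕ} {x : ℝ} {R : Fin n → Matrix (Fin d) (Fin d) ℂ}
    (hproj : ∀ v, IsProjection (R v)) (hsum : ∑ v, R v = (x : ℂ) • 1)
    (X : Matrix (Fin d) (Fin d) ℂ) :
    ∑ v, ((R v * X - R v * X * R v)ᴴ * (R v * X - R v * X * R v)).trace
      = (x : ℂ) * (Xᴴ * X).trace - (Xᴴ * ∑ v, R v * X * R v).trace := by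
  simp only [key2 (hproj _), Finset.sum_sub_distrib, ← Matrix.trace_sum, ← Finset.mul_sum,
    ← Finset.sum_mul, hsum]
  simp

theorem half_comm {n d : ℕ} {x : ℝ} {R : Fin n → Matrix (Fin d) (Fin d) ℂ}
    (hproj : ∀ v, IsProjection (R v)) (hsum : ∑ v, R v = (x : ℂ) • 1)
    (X : Matrix (Fin d) (Fin d) ℂ) (hX : ∑ v, R v * X * R v = (x : ℂ) • X) (v : Fin n) :
    R v * X = R v * X * R v := by
  have h := sum_key2 hproj hsum X
  rw [hX] at h
  simp only [Matrix.mul_smul, Matrix.trace_smul, smul_eq_mul, sub_self] at h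
  rw [Finset.sum_eq_zero_iff_of_nonneg (fun i _ => tr_nonneg _)] at h
  have h' := h v (Finset.mem_univ v)
  rw [Matrix.trace_conjTranspose_mul_self_eq_zero_iff] at h'
  exact sub_eq_zero.mp h'

theorem full_comm {n d : ℕ} {x : ℝ} {R : Fin n → Matrix (Fin d) (Fin d) ℂ}
    (hproj : ∀ v, IsProjection (R v)) (hsum : ∑ v, R v = (x : ℂ) • 1)
    (X : Matrix (Fin d) (Fin d) ℂ) (hX : ∑ v, R v * X * R v = (x : ℂ) • X) (v : Fin n) :
    R v * X = X * R v := by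
  have h1 := half_comm hproj hsum X hX v
  have hX' : ∑ v, R v * Xᴴ * R v = (x : ℂ) • Xᴴ := by
    have := congrArg Matrix.conjTranspose hX
    simpa [Matrix.conjTranspose_sum, Matrix.conjTranspose_mul, (hproj _).1,
      Matrix.mul_assoc] using this
  have h2 := congrArg Matrix.conjTranspose (half_comm hproj hsum _ hX' v)
  simp only [Matrix.conjTranspose_mul, (hproj _).1, Matrix.conjTranspose_conjTranspose] at h2
  rw [h1, h2, Matrix.mul_assoc]

theorem scalar_of_comm {n b d : ℕ} {x : ℝ} (hd : 0 < d) (hcop : Nat.Coprime b d)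
    (hbd : x = (b : ℝ) / d) {R : Fin n → Matrix (Fin d) (Fin d) ℂ}
    (hproj : ∀ v, IsProjection (R v)) (hsum : ∑ v, R v = (x : ℂ) • 1)
    (X : Matrix (Fin d) (Fin d) ℂ) (hX : ∀ v, R v * X = X * R v) :
    ∃ c : ℂ, X = c • 1 := by
  have : Nonempty (Fin d) := ⟨⟨0, hd⟩⟩
  obtain ⟨c, hc⟩ := Module.End.exists_eigenvalue (Matrix.toLin' X)
  set E := Module.End.eigenspace (Matrix.toLin' X) c with hE
  have hmem : ∀ w, w ∈ E ↔ X.mulVec w = c • w := by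
    intro w; rw [hE, Module.End.mem_eigenspace_iff, Matrix.toLin'_apply]
  have hinv : ∀ v, ∀ w ∈ E, Matrix.toLin' (R v) w ∈ E := by
    intro v w hw
    rw [hmem] at hw ⊢
    rw [Matrix.toLin'_apply, Matrix.mulVec_mulVec, ← hX, ← Matrix.mulVec_mulVec, hw,
      Matrix.mulVec_smul]
  let T : Fin n → (E →ₗ[ℂ] E) := fun v => (Matrix.toLin' (R v)).restrict (hinv v)
  have hT : ∀ v, IsIdempotentElem (T v) := by
    intro v
    apply LinearMap.ext
    intro w
    apply Subtype.ext
    change (R v).mulVec ((R v).mulVec w) = (R v).mulVec w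
    rw [Matrix.mulVec_mulVec, (hproj v).2]
  have hTs : ∑ v, T v = (x : ℂ) • LinearMap.id := by
    apply LinearMap.ext
    intro w
    apply Subtype.ext
    have : ((∑ v, T v) w : Fin d → ℂ) = (∑ v, R v).mulVec w := by
      rw [Matrix.sum_mulVec, LinearMap.sum_apply, Submodule.coe_sum]
      rfl
    rw [this, hsum, Matrix.smul_mulVec, Matrix.one_mulVec]
    rfl
  have htr : ∀ v, ∃ k : ℕ, LinearMap.trace ℂ E (T v) = k := fun v =>
    tr_idem (T v) (hT v)
  choose k hk using htr
  have h1 : (∑ v, (k v : ℂ)) = x * (Module.finrank ℂ E : ℂ) := by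
    have := congrArg (LinearMap.trace ℂ E) hTs
    rw [map_sum, map_smul, LinearMap.trace_id] at this
    simpa [hk] using this
  have hd0 : (d : ℂ) ≠ 0 := by exact_mod_cast hd.ne'
  have h2 : (∑ v, k v) * d = b * Module.finrank ℂ E := by
    have : (∑ v, (k v : ℂ)) * d = b * Module.finrank ℂ E := by
      rw [h1, hbd]; push_cast; field_simp
    exact_mod_cast this
  have h3 : d ∣ Module.finrank ℂ E :=
    hcop.symm.dvd_of_dvd_mul_left ⟨_, by rw [← h2, mul_comm]⟩
  have hne : E ≠ ⊥ := hc
  have hpos : 0 < Module.finrank ℂ E := by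
    have := Submodule.nontrivial_iff_ne_bot.mpr hne
    exact Module.finrank_pos
  have htop : E = ⊤ := by
    apply Submodule.eq_top_of_finrank_eq
    apply le_antisymm (Submodule.finrank_le E)
    simpa using Nat.le_of_dvd hpos h3
  refine ⟨c, ?_⟩
  apply Matrix.toLin'.injective
  apply LinearMap.ext
  intro w
  have : w ∈ E := htop ▸ Submodule.mem_top
  rw [Matrix.toLin'_apply, Matrix.toLin'_apply, (hmem w).1 this, Matrix.smul_mulVec,
    Matrix.one_mulVec]

theorem statement10 {n b d : ℕ} (hn : 3 ≤ n) (x : ℝ) (hx : x ∈ Lambda n)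
    (hd : 0 < d) (hcop : Nat.Coprime b d) (hbd : x = (b : ℝ) / d)
    (R : Fin n → Matrix (Fin d) (Fin d) ℂ)
    (hproj : ∀ v, IsProjection (R v)) (hsum : ∑ v, R v = (x : ℂ) • 1) :
    (∑ v, R v ⊗ₖ (R v)ᵀ).mulVec (phid d) = (x : ℂ) • phid d ∧
    (∀ (μ : ℂ) (ξ : Fin d × Fin d → ℂ), ξ ≠ 0 →
      (∑ v, R v ⊗ₖ (R v)ᵀ).mulVec ξ = μ • ξ → ‖μ‖ ≤ x) ∧
    ∀ ξ : Fin d × Fin d → ℂ,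
      (∑ v, R v ⊗ₖ (R v)ᵀ).mulVec ξ = (x : ℂ) • ξ →
      ∃ c : ℂ, ξ = c • phid d := by
  have hpos : ∀ X : Matrix (Fin d) (Fin d) ℂ, X ≠ 0 → 0 < (Xᴴ * X).trace := fun X h =>
    lt_of_le_of_ne (tr_nonneg X) fun h' =>
      h (Matrix.trace_conjTranspose_mul_self_eq_zero_iff.mp h'.symm)
  refine ⟨?_, ?_, ?_⟩
  · apply matOf_inj
    rw [matOf_mulVec, matOf_smul, matOf_phid]
    simp only [Matrix.mul_smul, Matrix.smul_mul, Matrix.mul_one, (hproj _).2, ← Finset.smul_sum,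
      hsum]
    rw [smul_comm]
  · intro μ ξ hξ h
    have hX : matOf ξ ≠ 0 := fun h0 => hξ (matOf_inj (h0.trans (by ext i j; simp [matOf])))
    have h := congrArg matOf h
    rw [matOf_mulVec, matOf_smul] at h
    have ht := hpos _ hX
    have h2 : 0 ≤ μ * ((matOf ξ)ᴴ * matOf ξ).trace := by
      have : μ * ((matOf ξ)ᴴ * matOf ξ).trace
          = ∑ v, ((R v * matOf ξ * R v)ᴴ * (R v * matOf ξ * R v)).trace := by
        simp only [key1 (hproj _), ← Matrix.trace_sum, ← Finset.mul_sum, h]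
        simp
      rw [this]
      exact Finset.sum_nonneg fun v _ => tr_nonneg _
    have h3 : 0 ≤ ((x : ℂ) - μ) * ((matOf ξ)ᴴ * matOf ξ).trace := by
      have h4 := sum_key2 hproj hsum (matOf ξ)
      rw [h, Matrix.mul_smul, Matrix.trace_smul, smul_eq_mul, ← sub_mul] at h4
      rw [← h4]
      exact Finset.sum_nonneg fun v _ => tr_nonneg _
    have h5 : 0 ≤ μ := cx_nonneg h2 ht
    have h6 : μ ≤ x := sub_nonneg.mp (cx_nonneg h3 ht)
    have h7 : (‖μ‖ : ℂ) = μ := Complex.norm_of_nonneg' h5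
    rw [← h7] at h6
    exact_mod_cast h6
  · intro ξ h
    have h := congrArg matOf h
    rw [matOf_mulVec, matOf_smul] at h
    obtain ⟨c, hc⟩ := scalar_of_comm hd hcop hbd hproj hsum _ (full_comm hproj hsum _ h)
    have hs : ((Real.sqrt d : ℝ) : ℂ) ≠ 0 := by
      exact_mod_cast (Real.sqrt_pos.mpr (by exact_mod_cast hd)).ne'
    refine ⟨c * (Real.sqrt d : ℝ), matOf_inj ?_⟩
    rw [matOf_smul, matOf_phid, hc, smul_smul]
    push_cast
    rw [mul_assoc, mul_inv_cancel₀ hs, mul_one]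

end QST
end
end
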